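/- Let (R,m) be a regular local ring of dimension n and let M be a finitely generated R-module of finite projective dimension. Assume the order ideal conjecture holds for every regular local ring of dimension n−1. If the annihilator ann_R M contains an element of m ∖ m², or if depth_R M > 0, then M satisfies the order ideal conjecture: for every i ≥ 0 and every minimal generator y of the i-th syzygy module Syz^i_R(M) (the image of the i-th differential in a minimal free resolution of M), the order ideal O(y) has grade at least i. -/

import Mathlib

open IsLocalRing

universe u

variable (R : Type u) [CommRing R]

/-- A projective resolution `⋯ → F 1 → F 0 → M → 0` of an `R`-module `M`. -/
structure ProjRes (M : Type u) [AddCommGroup M] [Module R M] where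
  F : ℕ → ModuleCat.{u} R
  d : ∀ n, F (n + 1) →ₗ[R] F n
  ε : F 0 →ₗ[R] M
  projective : ∀ n, Module.Projective R (F n)
  surj : Function.Surjective ε
  exact0 : LinearMap.ker ε = LinearMap.range (d 0)
  exact : ∀ n, LinearMap.ker (d n) = LinearMap.range (d (n + 1))

/-- A minimal free resolution of `M` over the local ring `R`: a resolution by
finitely generated free modules all of whose differentials (and the kernel of
whose augmentation) land in `m` times the target. -/
structure MinFreeRes [IsLocalRing R] (M : Type u) [AddCommGroup M] [Module R M]
    extends ProjRes R M where
  free : ∀ n, Module.Free R (F n)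
  fin : ∀ n, Module.Finite R (F n)
  min_aug : LinearMap.ker ε ≤ (maximalIdeal R) • (⊤ : Submodule R (F 0))
  min : ∀ n, LinearMap.range (d n) ≤ (maximalIdeal R) • (⊤ : Submodule R (F n))

/-- The grade of the ideal `J` is at least `k`: either `J = R` (grade `+∞` by
convention), or `J` contains a weakly `R`-regular sequence of length `k`. -/
def GradeGE (J : Ideal R) (k : ℕ) : Prop :=
  J = ⊤ ∨ ∃ rs : List R, rs.length = k ∧ (∀ r ∈ rs, r ∈ J) ∧
    RingTheory.Sequence.IsWeaklyRegular R rs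

/-- The order ideal `O_M(y) = {f(y) : f ∈ Hom_R(M, R)}` of `y : M`. -/
def orderIdeal {M : Type u} [AddCommGroup M] [Module R M] (y : M) : Ideal R :=
  LinearMap.range (LinearMap.applyₗ (R := R) (M := M) (M₂ := R) y)

/-- `M` has a finite resolution by finitely generated free modules; for a
finitely generated module over a Noetherian local ring this says exactly that
`M` has finite projective dimension. -/
def HasFiniteFreeResolution (M : Type u) [AddCommGroup M] [Module R M] : Prop :=
  ∃ (P : ProjRes R M) (n : ℕ),
    (∀ j, Module.Free R (P.F j) ∧ Module.Finite R (P.F j)) ∧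
    ∀ j, n ≤ j → Subsingleton (P.F j)

/-- `M` is a `k`-th syzygy: there is an exact sequence
`0 → M → F_{k-1} → ⋯ → F_0 → N → 0` with the `F_j` finitely generated free;
equivalently (continuing the resolution), `M` is isomorphic to the `k`-th syzygy
module `im(d_{k-1})` of some resolution of `N` by finitely generated free
modules. -/
def IsSyzygy (k : ℕ) (M : Type u) [AddCommGroup M] [Module R M] : Prop :=
  match k with
  | 0 => True
  | (j + 1) => ∃ (N : Type u) (_ : AddCommGroup N) (_ : Module R N)
      (P : ProjRes R N),
        (∀ n, Module.Free R (P.F n) ∧ Module.Finite R (P.F n)) ∧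
        Nonempty (M ≃ₗ[R] ↥(LinearMap.range (P.d j)))

/-- The order ideal conjecture holds for the local ring `R`: for every finitely
generated `R`-module `M` of finite projective dimension which is a `k`-th syzygy
and every minimal generator `y` of `M` (i.e. `y ∉ mM`), the order ideal `O_M(y)`
has grade at least `k`. -/
def OrderIdealConjecture [IsLocalRing R] : Prop :=
  ∀ (M : Type u) (_ : AddCommGroup M) (_ : Module R M),
    Module.Finite R M → HasFiniteFreeResolution R M →
      ∀ k : ℕ, IsSyzygy R k M →
        ∀ y : M, y ∉ (maximalIdeal R) • (⊤ : Submodule R M) →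
          GradeGE R (orderIdeal R y) k

/-- `R` is a regular local ring: a Noetherian local ring whose maximal ideal is
generated by `dim R` elements. -/
def IsRegularLocal [IsLocalRing R] : Prop :=
  IsNoetherianRing R ∧ ∃ (n : ℕ) (x : Fin n → R),
    Ideal.span (Set.range x) = maximalIdeal R ∧ ringKrullDim R = n

section ProjectiveDimension

open CategoryTheory

variable {A : Type u} [CommRing A]

/-- The module `M` has projective dimension at most `n`. -/
abbrev PdLE (A : Type u) [CommRing A] (M : Type u) [AddCommGroup M] [Module A M] (n : ℕ) : Prop :=
  HasProjectiveDimensionLE (ModuleCat.of A M) n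

variable {M N F : Type u} [AddCommGroup M] [Module A M] [AddCommGroup N] [Module A N]
  [AddCommGroup F] [Module A F]

theorem pdLE_zero_iff : PdLE A M 0 ↔ Module.Projective A M := by
  rw [PdLE, ← projective_iff_hasProjectiveDimensionLE_zero]
  exact (IsProjective.iff_projective (R := A) M).symm

theorem PdLE.congr {n : ℕ} (e : M ≃ₗ[A] N) (h : PdLE A M n) : PdLE A N n :=
  hasProjectiveDimensionLT_of_iso e.toModuleIso (n + 1)

theorem PdLE.mono {m n : ℕ} (hmn : m ≤ n) (h : PdLE A M m) : PdLE A M n :=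
  hasProjectiveDimensionLT_of_ge _ (m + 1) (n + 1) (by omega)

theorem pdLE_succ_iff_of_exact [Module.Projective A F] {K : Type u} [AddCommGroup K] [Module A K]
    (g : K →ₗ[A] F) (f : F →ₗ[A] M) (hg : Function.Injective g) (hfg : Function.Exact g f)
    (hf : Function.Surjective f) {n : ℕ} : PdLE A M (n + 1) ↔ PdLE A K n := by
  let S : ShortComplex (ModuleCat.{u} A) :=
    ⟨ModuleCat.ofHom g, ModuleCat.ofHom f, by
      ext x; exact hfg.apply_apply_eq_zero x⟩
  have hS : S.ShortExact := by
    have := (ModuleCat.mono_iff_injective S.f).2 hg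
    have := (ModuleCat.epi_iff_surjective S.g).2 hf
    exact ⟨(ShortComplex.ShortExact.moduleCat_exact_iff_function_exact S).2 hfg⟩
  exact hS.hasProjectiveDimensionLT_X₃_iff n
    ((IsProjective.iff_projective (R := A) F).1 inferInstance)

theorem pdLE_succ_iff_ker [Module.Projective A F] (f : F →ₗ[A] M) (hf : Function.Surjective f)
    {n : ℕ} : PdLE A M (n + 1) ↔ PdLE A (LinearMap.ker f) n :=
  pdLE_succ_iff_of_exact (LinearMap.ker f).subtype f (Submodule.subtype_injective _)
    (LinearMap.exact_subtype_ker_map f) hf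

end ProjectiveDimension

section Shift

variable {A : Type u} [CommRing A] {M : Type u} [AddCommGroup M] [Module A M]

/-- The resolution of the first syzygy obtained by dropping the first term. -/
def ProjRes.shift (P : ProjRes A M) : ProjRes A (LinearMap.range (P.d 0)) where
  F n := P.F (n + 1)
  d n := P.d (n + 1)
  ε := (P.d 0).rangeRestrict
  projective n := P.projective (n + 1)
  surj := (P.d 0).surjective_rangeRestrict
  exact0 := by rw [LinearMap.ker_rangeRestrict]; exact P.exact 0
  exact n := P.exact (n + 1)

/-- The minimal resolution of the first syzygy obtained by dropping the first term. -/
def MinFreeRes.shift [IsLocalRing A] (Q : MinFreeRes A M) :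
    MinFreeRes A (LinearMap.range (Q.d 0)) where
  toProjRes := Q.toProjRes.shift
  free n := Q.free (n + 1)
  fin n := Q.fin (n + 1)
  min_aug := by
    change LinearMap.ker (Q.d 0).rangeRestrict ≤ _
    rw [LinearMap.ker_rangeRestrict, Q.exact 0]
    exact Q.min 1
  min n := Q.min (n + 1)

theorem ProjRes.pdLE_succ_iff (P : ProjRes A M) {n : ℕ} :
    PdLE A M (n + 1) ↔ PdLE A (LinearMap.range (P.d 0)) n := by
  have := P.projective 0
  rw [pdLE_succ_iff_ker P.ε P.surj, P.exact0]

theorem exists_pdLE_of_subsingleton (n : ℕ) : ∀ {M : Type u} [AddCommGroup M] [Module A M]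
    (P : ProjRes A M), (∀ j, n ≤ j → Subsingleton (P.F j)) → ∃ k, PdLE A M k := by
  induction n with
  | zero =>
    intro M _ _ P hP
    have := hP 0 le_rfl
    have : Subsingleton M := P.surj.subsingleton
    exact ⟨0, pdLE_zero_iff.2 inferInstance⟩
  | succ n ih =>
    intro M _ _ P hP
    obtain ⟨k, hk⟩ := ih P.shift fun j hj => hP (j + 1) (by omega)
    exact ⟨k + 1, P.pdLE_succ_iff.2 hk⟩

theorem HasFiniteFreeResolution.exists_pdLE (h : HasFiniteFreeResolution A M) :
    ∃ k, PdLE A M k := by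
  obtain ⟨P, n, -, hP⟩ := h
  exact exists_pdLE_of_subsingleton n P hP

theorem eq_bot_of_isCompl_of_le_smul [IsLocalRing A] [Module.Finite A M] {K L : Submodule A M}
    (h : IsCompl K L) (hK : K ≤ maximalIdeal A • (⊤ : Submodule A M)) : K = ⊥ := by
  have hL : L = ⊤ := by
    have := Submodule.le_of_le_smul_of_le_jacobson_bot (N := L) (N' := ⊤) (I := maximalIdeal A)
      Module.Finite.fg_top (maximalIdeal_le_jacobson _)
      (by rw [← h.symm.sup_eq_top]
          exact sup_le_sup_left (h.symm.sup_eq_top ▸ hK) _)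
    exact top_le_iff.1 this
  have := h.inf_eq_bot
  rwa [hL, inf_top_eq] at this

theorem MinFreeRes.subsingleton_of_subsingleton [IsLocalRing A] (j : ℕ) :
    ∀ {M : Type u} [AddCommGroup M] [Module A M] [Subsingleton M]
    (Q : MinFreeRes A M), Subsingleton (Q.F j) := by
  have key : ∀ {M : Type u} [AddCommGroup M] [Module A M] [Subsingleton M]
      (Q : MinFreeRes A M), Subsingleton (Q.F 0) := by
    intro M _ _ _ Q
    have := Q.fin 0
    have h : (⊤ : Submodule A (Q.F 0)) = ⊥ := by
      refine Submodule.eq_bot_of_le_smul_of_le_jacobson_bot (maximalIdeal A) _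
        Module.Finite.fg_top ?_ (maximalIdeal_le_jacobson _)
      exact le_trans (fun x _ => Subsingleton.elim _ _) Q.min_aug
    exact Submodule.subsingleton_iff A |>.1 (subsingleton_of_bot_eq_top h.symm)
  induction j with
  | zero => exact key
  | succ j ih =>
    intro M _ _ _ Q
    have := key Q
    have : Subsingleton (LinearMap.range (Q.d 0)) := inferInstance
    exact ih Q.shift

theorem MinFreeRes.subsingleton_of_pdLE [IsLocalRing A] (n : ℕ) :
    ∀ {M : Type u} [AddCommGroup M] [Module A M] (Q : MinFreeRes A M), PdLE A M n →
      ∀ j, n < j → Subsingleton (Q.F j) := by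
  induction n with
  | zero =>
    intro M _ _ Q h j hj
    have := pdLE_zero_iff.1 h
    obtain ⟨s, hs⟩ := Module.projective_lifting_property Q.ε LinearMap.id Q.surj
    have := Q.fin 0
    have h0 := eq_bot_of_isCompl_of_le_smul
      (LinearMap.isCompl_of_proj (p := LinearMap.ker Q.ε)
        (f := (LinearMap.id - s ∘ₗ Q.ε).codRestrict _ fun x => by
          have := LinearMap.congr_fun hs (Q.ε x)
          simp at this
          simp [this]) (fun x => by ext; simp)) Q.min_aug
    rw [Q.exact0] at h0
    have : Subsingleton (LinearMap.range (Q.d 0)) := by rw [h0]; infer_instance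
    obtain ⟨j, rfl⟩ : ∃ k, j = k + 1 := ⟨j - 1, by omega⟩
    exact Q.shift.subsingleton_of_subsingleton j
  | succ n ih =>
    intro M _ _ Q h j hj
    obtain ⟨j, rfl⟩ : ∃ k, j = k + 1 := ⟨j - 1, by omega⟩
    exact ih Q.shift (Q.pdLE_succ_iff.1 h) j (by omega)

end Shift

section QuotSMulTop

open Pointwise

variable {A : Type u} [CommRing A] {M N K : Type u} [AddCommGroup M] [Module A M]
  [AddCommGroup N] [Module A N] [AddCommGroup K] [Module A K]

/-- The map `M/xM → N/xN` induced by `f : M → N`, linear over `A/(x)`. -/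
noncomputable def quotMap (x : A) (f : M →ₗ[A] N) :
    QuotSMulTop x M →ₗ[A ⧸ Ideal.span {x}] QuotSMulTop x N :=
  (QuotSMulTop.map x f).extendScalarsOfSurjective Ideal.Quotient.mk_surjective

@[simp]
theorem quotMap_mk (x : A) (f : M →ₗ[A] N) (m : M) :
    quotMap x f (Submodule.Quotient.mk m) = Submodule.Quotient.mk (f m) := rfl

theorem quotSMulTop_mk_eq_zero {x : A} {m : M} :
    (Submodule.Quotient.mk m : QuotSMulTop x M) = 0 ↔ ∃ m', x • m' = m := by
  rw [Submodule.Quotient.mk_eq_zero, Submodule.mem_smul_pointwise_iff_exists]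
  simp

theorem quotMap_surjective (x : A) {f : M →ₗ[A] N} (hf : Function.Surjective f) :
    Function.Surjective (quotMap x f) := by
  intro b
  obtain ⟨b, rfl⟩ := Submodule.Quotient.mk_surjective _ b
  obtain ⟨a, rfl⟩ := hf b
  exact ⟨Submodule.Quotient.mk a, rfl⟩

/-- Exactness of `K/xK → M/xM → N/xN` only needs exactness and `N/im M` to be `x`-regular. -/
theorem quotMap_exact (x : A) {g : K →ₗ[A] M} {f : M →ₗ[A] N} (h : Function.Exact g f)
    (hreg : ∀ n : N, x • n ∈ LinearMap.range f → n ∈ LinearMap.range f) :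
    Function.Exact (quotMap x g) (quotMap x f) := by
  intro b
  obtain ⟨b, rfl⟩ := Submodule.Quotient.mk_surjective _ b
  constructor
  · intro hb
    rw [quotMap_mk, quotSMulTop_mk_eq_zero] at hb
    obtain ⟨n, hn⟩ := hb
    obtain ⟨c, rfl⟩ := hreg n ⟨b, hn.symm⟩
    obtain ⟨k, hk⟩ := (h (b - x • c)).1 (by simp [hn])
    refine ⟨Submodule.Quotient.mk k, ?_⟩
    rw [quotMap_mk, hk, ← sub_eq_zero, ← Submodule.Quotient.mk_sub, quotSMulTop_mk_eq_zero]
    exact ⟨-c, by simp⟩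
  · rintro ⟨k, hk⟩
    obtain ⟨k, rfl⟩ := Submodule.Quotient.mk_surjective _ k
    rw [← hk, quotMap_mk, quotMap_mk, h.apply_apply_eq_zero, Submodule.Quotient.mk_zero]

theorem quotMap_injective {x : A} {g : K →ₗ[A] M} {f : M →ₗ[A] N} (hg : Function.Injective g)
    (h : Function.Exact g f) (hN : IsSMulRegular N x) :
    Function.Injective (quotMap x g) := by
  rw [injective_iff_map_eq_zero]
  intro b hb
  obtain ⟨b, rfl⟩ := Submodule.Quotient.mk_surjective _ b
  rw [quotMap_mk, quotSMulTop_mk_eq_zero] at hb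
  obtain ⟨m, hm⟩ := hb
  have : f m = 0 := by
    apply hN
    change x • f m = x • 0
    rw [← map_smul, hm, h.apply_apply_eq_zero, smul_zero]
  obtain ⟨k, rfl⟩ := (h m).1 this
  rw [quotSMulTop_mk_eq_zero]
  exact ⟨k, hg (by rw [map_smul, hm])⟩

theorem isSMulRegular_of_free {x : A} (hA : IsSMulRegular A x) [Module.Free A M] :
    IsSMulRegular M x := by
  intro a b hab
  apply (Module.Free.chooseBasis A M).repr.injective
  ext i
  apply hA
  have := congrArg (fun z => (Module.Free.chooseBasis A M).repr z i) hab
  simpa using this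

theorem isSMulRegular_submodule {x : A} (hM : IsSMulRegular M x) (L : Submodule A M) :
    IsSMulRegular L x :=
  fun _ _ hab => Subtype.ext (hM (congrArg Subtype.val hab))

theorem isLocalRing_quotient_span [IsLocalRing A] {x : A} (hx : x ∈ maximalIdeal A) :
    IsLocalRing (A ⧸ Ideal.span {x}) := by
  have : Nontrivial (A ⧸ Ideal.span {x}) := Ideal.Quotient.nontrivial_iff.2 fun h => by
    rw [Ideal.span_singleton_eq_top] at h
    exact hx h
  exact IsLocalRing.of_surjective' (Ideal.Quotient.mk _) Ideal.Quotient.mk_surjective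

theorem projective_iff_free [IsLocalRing A] [IsNoetherianRing A] [Module.Finite A M] :
    Module.Projective A M ↔ Module.Free A M :=
  ⟨fun _ => Module.free_of_flat_of_isLocalRing, fun _ => inferInstance⟩

theorem pdLE_quotSMulTop_iff [IsLocalRing A] [IsNoetherianRing A] {x : A}
    (hx : x ∈ maximalIdeal A) (hA : IsSMulRegular A x) (n : ℕ) :
    ∀ {K : Type u} [AddCommGroup K] [Module A K] [Module.Finite A K], IsSMulRegular K x →
      (PdLE A K n ↔ PdLE (A ⧸ Ideal.span {x}) (QuotSMulTop x K) n) := by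
  have := isLocalRing_quotient_span hx
  induction n with
  | zero =>
    intro K _ _ _ hK
    have : Module.Finite (A ⧸ Ideal.span {x}) (QuotSMulTop x K) :=
      Module.Finite.of_restrictScalars_finite A _ _
    have := Module.finitePresentation_of_finite A K
    rw [pdLE_zero_iff, pdLE_zero_iff, projective_iff_free, projective_iff_free,
      Module.free_quotSMulTop_iff_free _ _ (maximalIdeal_le_jacobson _ hx) hK]
  | succ n ih =>
    intro K _ _ _ hK
    obtain ⟨m, f, hf⟩ := Module.Finite.exists_fin' A K
    have hex : Function.Exact (LinearMap.ker f).subtype f := LinearMap.exact_subtype_ker_map f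
    have hF : IsSMulRegular (Fin m → A) x := isSMulRegular_of_free hA
    rw [pdLE_succ_iff_of_exact _ f (Submodule.subtype_injective _) hex hf,
      ih (isSMulRegular_submodule hF _)]
    refine (pdLE_succ_iff_of_exact _ (quotMap x f)
      (quotMap_injective (Submodule.subtype_injective _) hex hK) (quotMap_exact x hex ?_)
      (quotMap_surjective x hf)).symm
    intro n _
    exact hf n

end QuotSMulTop

section MinimalCover

variable {A : Type u} [CommRing A]

theorem apply_mem_of_mem_smul_top {M : Type*} [AddCommGroup M] [Module A M] {I : Ideal A} {c : M}
    (hc : c ∈ I • (⊤ : Submodule A M)) (f : M →ₗ[A] A) : f c ∈ I := by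
  induction hc using Submodule.smul_induction_on' with
  | smul r hr m _ => rw [map_smul]; exact Ideal.mul_mem_right _ _ hr
  | add x _ y _ hx hy => rw [map_add]; exact add_mem hx hy

theorem mem_smul_top_pi_iff {ι : Type*} [Fintype ι] {I : Ideal A} {c : ι → A} :
    c ∈ I • (⊤ : Submodule A (ι → A)) ↔ ∀ j, c j ∈ I := by
  classical
  refine ⟨fun hc j => apply_mem_of_mem_smul_top hc (LinearMap.proj j), fun hc => ?_⟩
  rw [pi_eq_sum_univ c]
  exact Submodule.sum_mem _ fun j _ => Submodule.smul_mem_smul (hc j) trivial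

theorem exists_surjective_of_isUnit_apply {M : Type u} [AddCommGroup M] [Module A M] {k : ℕ}
    {f : (Fin (k + 1) → A) →ₗ[A] M} (hf : Function.Surjective f) {c : Fin (k + 1) → A}
    (hc : f c = 0) {j : Fin (k + 1)} (hj : IsUnit (c j)) :
    ∃ g : (Fin k → A) →ₗ[A] M, Function.Surjective g := by
  obtain ⟨e, he⟩ := hj.exists_right_inv
  refine ⟨f ∘ₗ Function.ExtendByZero.linearMap A j.succAbove, fun m => ?_⟩
  obtain ⟨v, rfl⟩ := hf m
  refine ⟨fun l => (v - (v j * e) • c) (j.succAbove l), ?_⟩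
  have : Function.ExtendByZero.linearMap A j.succAbove
      (fun l => (v - (v j * e) • c) (j.succAbove l)) = v - (v j * e) • c := by
    funext l
    refine Fin.succAboveCases j ?_ (fun l => ?_) l
    · rw [Function.ExtendByZero.linearMap_apply, Function.extend_apply' _ _ _ (by
        rintro ⟨a, ha⟩; exact Fin.succAbove_ne j a ha)]
      simp only [Pi.sub_apply, Pi.smul_apply, smul_eq_mul, Pi.zero_apply]
      linear_combination v j * he
    · rw [Function.ExtendByZero.linearMap_apply,
        Fin.succAbove_right_injective.extend_apply]
  rw [LinearMap.comp_apply, this, map_sub, map_smul, hc, smul_zero, sub_zero]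

/-- A finitely generated module over a local ring has a free cover with kernel in `mF`. -/
theorem exists_minimal_cover [IsLocalRing A] (M : Type u) [AddCommGroup M] [Module A M]
    [Module.Finite A M] : ∃ (n : ℕ) (f : (Fin n → A) →ₗ[A] M), Function.Surjective f ∧
      LinearMap.ker f ≤ maximalIdeal A • (⊤ : Submodule A (Fin n → A)) := by
  classical
  have hex : ∃ n, ∃ f : (Fin n → A) →ₗ[A] M, Function.Surjective f := Module.Finite.exists_fin' A M
  obtain ⟨n, ⟨f, hf⟩, hmin⟩ : ∃ n, (∃ f : (Fin n → A) →ₗ[A] M, Function.Surjective f) ∧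
      ∀ k < n, ¬ ∃ f : (Fin k → A) →ₗ[A] M, Function.Surjective f :=
    ⟨_, Nat.find_spec hex, fun k hk => Nat.find_min hex hk⟩
  refine ⟨n, f, hf, fun c hc => mem_smul_top_pi_iff.2 fun j => ?_⟩
  by_contra hj
  cases n with
  | zero => exact j.elim0
  | succ k =>
    exact hmin k (Nat.lt_succ_self k) (exists_surjective_of_isUnit_apply hf hc
      (by simpa using hj))

end MinimalCover

section AuslanderBuchsbaum

theorem mk_mem_maximalIdeal_iff {A : Type u} [CommRing A] [IsLocalRing A] {I : Ideal A}
    [IsLocalRing (A ⧸ I)] {b : A} :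
    Ideal.Quotient.mk I b ∈ maximalIdeal (A ⧸ I) ↔ b ∈ maximalIdeal A := by
  have := Ideal.comap_isMaximal_of_surjective (Ideal.Quotient.mk I) Ideal.Quotient.mk_surjective
    (K := maximalIdeal (A ⧸ I))
  rw [← eq_maximalIdeal this, Ideal.mem_comap]

open RingTheory.Sequence Pointwise

variable {A : Type u} [CommRing A]

/-- `A/xA` as the quotient module `A ⧸ x • ⊤`. -/
noncomputable def quotSMulTopSelf (x : A) :
    QuotSMulTop x A ≃ₗ[A ⧸ Ideal.span {x}] A ⧸ Ideal.span {x} :=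
  LinearEquiv.extendScalarsOfSurjective Ideal.Quotient.mk_surjective
    (Submodule.quotEquivOfEq _ _ (by
      rw [← Submodule.ideal_span_singleton_smul, smul_eq_mul, Ideal.mul_top]))

theorem isWeaklyRegular_cons_iff_quotient {x : A} {xs : List A} :
    IsWeaklyRegular A (x :: xs) ↔ IsSMulRegular A x ∧
      IsWeaklyRegular (A ⧸ Ideal.span {x}) (xs.map (Ideal.Quotient.mk (Ideal.span {x}))) := by
  rw [isWeaklyRegular_cons_iff', (quotSMulTopSelf x).isWeaklyRegular_congr]

theorem pdLE_zero_of_socle [IsLocalRing A] [IsNoetherianRing A] {a : A} (ha : a ≠ 0)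
    (hma : ∀ b ∈ maximalIdeal A, b * a = 0) (n : ℕ) :
    ∀ {M : Type u} [AddCommGroup M] [Module A M] [Module.Finite A M], PdLE A M n →
      PdLE A M 0 := by
  induction n with
  | zero => exact fun h => h
  | succ n ih =>
    intro M _ _ _ h
    obtain ⟨m, f, hf, hk⟩ := exists_minimal_cover (A := A) M
    have h0 := pdLE_zero_iff.1 (ih ((pdLE_succ_iff_ker f hf).1 h))
    have hfree := projective_iff_free.1 h0
    have hzero : ∀ k : LinearMap.ker f, a • k = 0 := fun k => by
      ext j
      have := mem_smul_top_pi_iff.1 (hk k.2) j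
      simpa [mul_comm] using hma _ this
    have hsub : Subsingleton (LinearMap.ker f) := by
      by_contra hns
      rw [not_subsingleton_iff_nontrivial] at hns
      let b := Module.Free.chooseBasis A (LinearMap.ker f)
      obtain ⟨j⟩ := b.index_nonempty
      have := congrArg (fun z => b.repr z j) (hzero (b j))
      exact ha (by simpa using this)
    have hinj : Function.Injective f :=
      LinearMap.ker_eq_bot.1 ((Submodule.subsingleton_iff_eq_bot).1 hsub)
    exact (pdLE_zero_iff.2 inferInstance).congr (LinearEquiv.ofBijective f ⟨hinj, hf⟩)

/-- If the maximal ideal is associated to a weakly regular sequence `x`, then every finitely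
generated module of finite projective dimension has projective dimension at most the length
of `x`. -/
theorem pdLE_length_of_socle (l : ℕ) :
    ∀ {A : Type u} [CommRing A] [IsLocalRing A] [IsNoetherianRing A] {xs : List A},
      xs.length = l → IsWeaklyRegular A xs → (∀ x ∈ xs, x ∈ maximalIdeal A) →
      ∀ {a : A}, a ∉ Ideal.ofList xs → (∀ b ∈ maximalIdeal A, b * a ∈ Ideal.ofList xs) →
      ∀ {n : ℕ} {M : Type u} [AddCommGroup M] [Module A M] [Module.Finite A M],
        PdLE A M n → PdLE A M l := by
  induction l with
  | zero =>
    intro A _ _ _ xs hl hxs hm a ha hma n M _ _ _ h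
    obtain rfl := List.length_eq_zero_iff.1 hl
    rw [Ideal.ofList_nil] at ha hma
    exact pdLE_zero_of_socle ha (fun b hb => (hma b hb : b * a ∈ (⊥ : Ideal A))) n h
  | succ l ih =>
    intro A _ _ _ xs hl hxs hm a ha hma n M _ _ _ h
    obtain ⟨x, xs, rfl⟩ := List.exists_cons_of_length_eq_add_one hl
    have hx : x ∈ maximalIdeal A := hm x (by simp)
    have hloc := isLocalRing_quotient_span hx
    rw [isWeaklyRegular_cons_iff_quotient] at hxs
    have hmem : ∀ b : A, Ideal.Quotient.mk (Ideal.span {x}) b ∈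
        Ideal.ofList (xs.map (Ideal.Quotient.mk (Ideal.span {x}))) ↔
        b ∈ Ideal.ofList (x :: xs) := fun b => by
      rw [← Ideal.map_ofList, ← Ideal.mem_comap,
        Ideal.comap_map_of_surjective _ Ideal.Quotient.mk_surjective, ← RingHom.ker_eq_comap_bot,
        Ideal.mk_ker, Ideal.ofList_cons, sup_comm]
    obtain ⟨m, f, hf⟩ := Module.Finite.exists_fin' A M
    have hreg : IsSMulRegular (LinearMap.ker f) x :=
      isSMulRegular_submodule (isSMulRegular_of_free hxs.1) _
    have : Module.Finite (A ⧸ Ideal.span {x}) (QuotSMulTop x (LinearMap.ker f)) :=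
      Module.Finite.of_restrictScalars_finite A _ _
    rw [pdLE_succ_iff_ker f hf, pdLE_quotSMulTop_iff hx hxs.1 l hreg]
    have hpd := (pdLE_quotSMulTop_iff hx hxs.1 n hreg).1
      ((pdLE_succ_iff_ker f hf).1 (h.mono (Nat.le_succ n)))
    refine ih (by simpa using hl) hxs.2 ?_ (a := Ideal.Quotient.mk _ a) ?_ ?_ hpd
    · intro b hb
      obtain ⟨b, hb', rfl⟩ := List.mem_map.1 hb
      exact mk_mem_maximalIdeal_iff.2 (hm b (List.mem_cons_of_mem _ hb'))
    · rwa [hmem]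
    · intro b hb
      obtain ⟨b, rfl⟩ := Ideal.Quotient.mk_surjective b
      rw [← map_mul, hmem]
      exact hma b (mk_mem_maximalIdeal_iff.1 hb)

end AuslanderBuchsbaum

section Localization

open RingTheory.Sequence

variable {A : Type u} [CommRing A]

theorem PdLE.localizedModule (S : Submonoid A) {M : Type u} [AddCommGroup M] [Module A M] {n : ℕ}
    (h : PdLE A M n) : PdLE (Localization S) (LocalizedModule S M) n := by
  have : CategoryTheory.HasProjectiveDimensionLE (ModuleCat.of A M) n := h
  have := ModuleCat.localizedModule_hasProjectiveDimensionLE n S (ModuleCat.of A M)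
  exact PdLE.congr (Shrink.linearEquiv (Localization S) (LocalizedModule S M)) this

theorem pdLE_localizedModule_succ_iff (S : Submonoid A) {M F : Type u} [AddCommGroup M]
    [Module A M] [AddCommGroup F] [Module A F] [Module.Projective A F] {f : F →ₗ[A] M}
    (hf : Function.Surjective f) {n : ℕ} :
    PdLE (Localization S) (LocalizedModule S M) (n + 1) ↔
      PdLE (Localization S) (LocalizedModule S (LinearMap.ker f)) n := by
  have : Module.Projective (Localization S) (LocalizedModule S F) :=
    Module.projective_of_isLocalizedModule S (LocalizedModule.mkLinearMap S F)
  exact pdLE_succ_iff_of_exact (LocalizedModule.map S (LinearMap.ker f).subtype)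
    (LocalizedModule.map S f)
    (LocalizedModule.map_injective S _ (LinearMap.ker f).injective_subtype)
    (LocalizedModule.map_exact S _ _ (LinearMap.exact_subtype_ker_map f))
    (LocalizedModule.map_surjective S f hf)

theorem ProjRes.projective_localizedModule_coker (S : Submonoid A) (i : ℕ) :
    ∀ {N : Type u} [AddCommGroup N] [Module A N] (P : ProjRes A N),
      PdLE (Localization S) (LocalizedModule S N) i →
      Module.Projective (Localization S)
        (LocalizedModule S (P.F i ⧸ LinearMap.range (P.d i))) := by
  induction i with
  | zero =>
    intro N _ _ P h
    let e : (P.F 0 ⧸ LinearMap.range (P.d 0)) ≃ₗ[A] N :=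
      (Submodule.quotEquivOfEq _ _ P.exact0.symm).trans
        (P.ε.quotKerEquivOfSurjective P.surj)
    have := pdLE_zero_iff.1 h
    exact Module.Projective.of_equiv (LinearEquiv.ofBijective (LocalizedModule.map S e.symm.toLinearMap)
      ⟨LocalizedModule.map_injective S _ e.symm.injective,
        LocalizedModule.map_surjective S _ e.symm.surjective⟩)
  | succ i ih =>
    intro N _ _ P h
    have := P.projective 0
    rw [pdLE_localizedModule_succ_iff S P.surj, P.exact0] at h
    exact ih P.shift h

/-- If `C_S` is projective, a surjection `q : F → C` from a finite module splits up to an element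
of `S`. -/
theorem exists_section_of_projective_localizedModule [IsNoetherianRing A] (S : Submonoid A)
    {F C : Type u} [AddCommGroup F] [Module A F] [AddCommGroup C] [Module A C] [Module.Finite A C]
    {q : F →ₗ[A] C} (hq : Function.Surjective q)
    [Module.Projective (Localization S) (LocalizedModule S C)] :
    ∃ (σ : C →ₗ[A] F) (s : S), ∀ c, q (σ c) = s • c := by
  have := Module.finitePresentation_of_finite A C
  obtain ⟨τ, hτ⟩ := Module.projective_lifting_property
    (LocalizedModule.map S q) LinearMap.id (LocalizedModule.map_surjective S q hq)
  obtain ⟨h, s, hs⟩ := Module.FinitePresentation.exists_lift_of_isLocalizedModule S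
    (LocalizedModule.mkLinearMap S F) (τ.restrictScalars A ∘ₗ LocalizedModule.mkLinearMap S C)
  obtain ⟨t, ht⟩ := Module.Finite.exists_smul_of_comp_eq_of_isLocalizedModule S
    (LocalizedModule.mkLinearMap S C) (q ∘ₗ h) (s • LinearMap.id) (by
      ext c
      have h1 := congrArg (LocalizedModule.map S q) (LinearMap.congr_fun hs c)
      have h2 := LinearMap.congr_fun hτ (LocalizedModule.mkLinearMap S C c)
      simp only [LocalizedModule.mkLinearMap_apply, LinearMap.comp_apply, LinearMap.smul_apply,
        LinearMap.id_apply, LinearMap.coe_restrictScalars, LocalizedModule.map_mk] at h1 h2 ⊢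
      rw [h1, Submonoid.smul_def, LinearMap.map_smul_of_tower, h2]
      exact ((LocalizedModule.mkLinearMap S C).map_smul (s : A) c).symm)
  refine ⟨t • h, t * s, fun c => ?_⟩
  have := LinearMap.congr_fun ht c
  simpa [mul_smul] using this

theorem exists_pdLE_localization_of_socle [IsNoetherianRing A] {p : Ideal A} [p.IsPrime]
    {w : List A} (hw : IsWeaklyRegular A w) {a : A} (ha : ∀ b, b ∈ p ↔ b * a ∈ Ideal.ofList w)
    {n : ℕ} {N : Type u} [AddCommGroup N] [Module A N] [Module.Finite A N] (hN : PdLE A N n) :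
    PdLE (Localization p.primeCompl) (LocalizedModule p.primeCompl N) w.length := by
  let B := Localization p.primeCompl
  have : IsNoetherianRing B := IsLocalization.isNoetherianRing p.primeCompl _ inferInstance
  have hloc : IsLocalRing B := IsLocalization.AtPrime.isLocalRing B p
  have hwp : ∀ x ∈ w, x ∈ p := fun x hx => (ha x).2 (Ideal.mul_mem_right _ _ (Ideal.subset_span hx))
  refine pdLE_length_of_socle w.length (xs := w.map (algebraMap A B)) (by simp)
    (hw.of_isLocalization B p.primeCompl) ?_ (a := algebraMap A B a) ?_ ?_ (hN.localizedModule _)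
  · intro x hx
    obtain ⟨x, hx', rfl⟩ := List.mem_map.1 hx
    exact (IsLocalization.AtPrime.to_map_mem_maximal_iff B p x).2 (hwp x hx')
  · rw [← Ideal.map_ofList, IsLocalization.algebraMap_mem_map_algebraMap_iff p.primeCompl]
    rintro ⟨s, hs, hsa⟩
    exact hs ((ha s).2 hsa)
  · intro b hb
    obtain ⟨x, s, rfl⟩ := IsLocalization.exists_mk'_eq p.primeCompl b
    have hx := (IsLocalization.AtPrime.mk'_mem_maximal_iff B p x s).1 hb
    rw [← Ideal.map_ofList, IsLocalization.mk'_eq_mul_mk'_one, mul_right_comm, ← map_mul]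
    exact Ideal.mul_mem_right _ _ (Ideal.mem_map_of_mem _ ((ha x).1 hx))

/-- A prime `p` of the form `(w : a)`, with `w` weakly regular of length at most `i`, contains the
order ideal of `y` in the `i`-th syzygy as soon as it contains the ideal of coordinates of `y`. -/
theorem orderIdeal_le_of_coe_le [IsNoetherianRing A] {p : Ideal A} [p.IsPrime]
    {w : List A} (hw : IsWeaklyRegular A w) {a : A} (ha : ∀ b, b ∈ p ↔ b * a ∈ Ideal.ofList w)
    {n : ℕ} {N : Type u} [AddCommGroup N] [Module A N] [Module.Finite A N] (hN : PdLE A N n)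
    (P : ProjRes A N) {i : ℕ} [Module.Finite A (P.F i)] (hi : w.length ≤ i)
    (y : LinearMap.range (P.d i)) (hy : orderIdeal A (y : P.F i) ≤ p) :
    orderIdeal A y ≤ p := by
  have := P.projective_localizedModule_coker p.primeCompl i
    ((exists_pdLE_localization_of_socle hw ha hN).mono hi)
  obtain ⟨σ, s, hσ⟩ := exists_section_of_projective_localizedModule p.primeCompl
    (Submodule.mkQ_surjective (LinearMap.range (P.d i)))
  let ρ : P.F i →ₗ[A] LinearMap.range (P.d i) :=
    (s.1 • LinearMap.id - σ ∘ₗ Submodule.mkQ _).codRestrict _ fun v => by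
      rw [← Submodule.Quotient.mk_eq_zero, ← Submodule.mkQ_apply, LinearMap.sub_apply, map_sub,
        LinearMap.comp_apply, hσ]
      simp [Submonoid.smul_def]
  have hρ : ρ y = s.1 • y := by
    have : Submodule.mkQ (LinearMap.range (P.d i)) (y : P.F i) = 0 :=
      (Submodule.Quotient.mk_eq_zero _).2 y.2
    ext
    simp only [ρ, LinearMap.codRestrict_apply, LinearMap.sub_apply, LinearMap.comp_apply, this]
    simp
  rintro _ ⟨f, rfl⟩
  have : f (ρ y) ∈ p := hy ⟨f ∘ₗ ρ, rfl⟩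
  rw [hρ, map_smul, smul_eq_mul] at this
  exact (Ideal.IsPrime.mem_or_mem ‹_› this).resolve_left s.2

end Localization

section Grade

open RingTheory.Sequence

variable {A : Type u} [CommRing A]

theorem isWeaklyRegular_concat_iff {xs : List A} {x : A} :
    IsWeaklyRegular A (xs ++ [x]) ↔ IsWeaklyRegular A xs ∧
      IsSMulRegular (A ⧸ (Ideal.ofList xs • ⊤ : Submodule A A)) x := by
  rw [isWeaklyRegular_append_iff, isWeaklyRegular_singleton_iff]

/-- An ideal without `M`-regular element is contained in an associated prime of `M`. -/
theorem exists_isSMulRegular_or_le_associatedPrime [IsNoetherianRing A] (M : Type*)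
    [AddCommGroup M] [Module A M] [Module.Finite A M] (J : Ideal A) :
    (∃ x ∈ J, IsSMulRegular M x) ∨ ∃ p ∈ associatedPrimes A M, J ≤ p := by
  by_cases h : ∃ x ∈ J, IsSMulRegular M x
  · exact Or.inl h
  · right
    push Not at h
    refine (J.subset_union_prime_finite (associatedPrimes.finite A M) (f := id) 0 0
      fun _ h _ _ => h.isPrime).1 ?_
    simp_rw [id, biUnion_associatedPrimes_eq_compl_regular]
    exact h

theorem mem_associatedPrimes_quotient_ofList [IsNoetherianRing A] {w : List A} {p : Ideal A}
    (hp : p ∈ associatedPrimes A (A ⧸ (Ideal.ofList w • ⊤ : Submodule A A))) :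
    p.IsPrime ∧ ∃ a, ∀ b, b ∈ p ↔ b * a ∈ Ideal.ofList w := by
  rw [AssociatedPrimes.mem_iff, isAssociatedPrime_iff] at hp
  obtain ⟨hp, a, rfl⟩ := hp
  obtain ⟨a, rfl⟩ := Submodule.Quotient.mk_surjective _ a
  refine ⟨hp, a, fun b => ?_⟩
  rw [Submodule.mem_colon_singleton, ← Submodule.Quotient.mk_smul, Submodule.mem_bot,
    Submodule.Quotient.mk_eq_zero, smul_eq_mul, smul_eq_mul, Ideal.mul_top]

/-- Comparison of the grades of two ideals, the smaller of which is proper, which are contained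
in the same associated primes of weakly regular sequences of length at most `i`. -/
theorem GradeGE.of_forall_associatedPrimes [IsLocalRing A] [IsNoetherianRing A] {c O : Ideal A}
    {i : ℕ} (hc : c ≤ maximalIdeal A)
    (H : ∀ w : List A, IsWeaklyRegular A w → w.length ≤ i →
      ∀ p ∈ associatedPrimes A (A ⧸ (Ideal.ofList w • ⊤ : Submodule A A)), c ≤ p → O ≤ p)
    (h : GradeGE A O (i + 1)) : GradeGE A c (i + 1) := by
  right
  by_cases hO : O = ⊤
  · have key : ∀ k ≤ i + 1, ∃ rs : List A, rs.length = k ∧ (∀ r ∈ rs, r ∈ c) ∧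
        IsWeaklyRegular A rs := by
      intro k
      induction k with
      | zero => exact fun _ => ⟨[], rfl, by simp, .nil A A⟩
      | succ k ih =>
        intro hk
        obtain ⟨rs, hl, hrs, hreg⟩ := ih (by omega)
        obtain ⟨x, hx, hxr⟩ | ⟨p, hp, hcp⟩ := exists_isSMulRegular_or_le_associatedPrime
          (A ⧸ (Ideal.ofList rs • ⊤ : Submodule A A)) c
        · refine ⟨rs ++ [x], by simp [hl], ?_, isWeaklyRegular_concat_iff.2 ⟨hreg, hxr⟩⟩
          simpa [or_imp, forall_and] using ⟨hrs, hx⟩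
        · have := H rs hreg (by omega) p hp hcp
          rw [hO, top_le_iff] at this
          exact absurd this hp.isPrime.ne_top
    exact key _ le_rfl
  · obtain ⟨zs, hl, hzs, hreg⟩ := h.resolve_left hO
    have hOm : O ≤ maximalIdeal A := le_maximalIdeal hO
    have key : ∀ (zs xs : List A), (xs ++ zs).length = i + 1 → (∀ r ∈ xs, r ∈ c) →
        (∀ r ∈ zs, r ∈ O) → IsWeaklyRegular A (xs ++ zs) →
        ∃ rs : List A, rs.length = i + 1 ∧ (∀ r ∈ rs, r ∈ c) ∧ IsWeaklyRegular A rs := by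
      intro zs
      induction zs with
      | nil =>
        intro xs hl hx _ hreg
        rw [List.append_nil] at hl hreg
        exact ⟨xs, hl, hx, hreg⟩
      | cons z zs ih =>
        intro xs hl hx hz hreg
        have hmem : ∀ r ∈ xs ++ zs, r ∈ maximalIdeal A := fun r hr =>
          (List.mem_append.1 hr).elim (fun h => hc (hx r h))
            fun h => hOm (hz r (List.mem_cons_of_mem _ h))
        have hz0 := hz z List.mem_cons_self
        have hreg' : IsWeaklyRegular A ((xs ++ zs) ++ [z]) := by
          refine isWeaklyRegular_of_perm_of_subset_maximalIdeal hreg ?_ ?_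
          · rw [List.append_assoc]
            exact List.Perm.append_left _ (List.perm_append_singleton z zs).symm
          · intro r hr
            have : r = z ∨ r ∈ xs ++ zs := by simp at hr ⊢; tauto
            rcases this with rfl | h
            exacts [hOm hz0, hmem r h]
        rw [isWeaklyRegular_concat_iff] at hreg'
        obtain ⟨x, hx', hxr⟩ | ⟨p, hp, hcp⟩ := exists_isSMulRegular_or_le_associatedPrime
          (A ⧸ (Ideal.ofList (xs ++ zs) • ⊤ : Submodule A A)) c
        · refine ih (x :: xs) (by simp at hl ⊢; omega)
            (fun r hr => (List.mem_cons.1 hr).elim (fun h => h ▸ hx') (hx r))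
            (fun r hr => hz r (List.mem_cons_of_mem _ hr)) ?_
          refine isWeaklyRegular_of_perm_of_subset_maximalIdeal
            (isWeaklyRegular_concat_iff.2 ⟨hreg'.1, hxr⟩)
            (List.perm_append_singleton x (xs ++ zs)) ?_
          intro r hr
          rcases List.mem_append.1 hr with h | h
          · exact hmem r h
          · rw [List.mem_singleton.1 h]
            exact hc hx'
        · have hOp := H _ hreg'.1 (by simp at hl ⊢; omega) p hp hcp
          have : z ∈ {r : A | IsSMulRegular (A ⧸ (Ideal.ofList (xs ++ zs) • ⊤ : Submodule A A)) r}ᶜ := by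
            rw [← biUnion_associatedPrimes_eq_compl_regular]
            exact Set.mem_biUnion hp (hOp hz0)
          exact absurd hreg'.2 this
    exact key zs [] hl (by simp) hzs hreg

theorem orderIdeal_coe_le_maximalIdeal [IsLocalRing A] {F : Type u} [AddCommGroup F] [Module A F]
    {v : F} (hv : v ∈ maximalIdeal A • (⊤ : Submodule A F)) :
    orderIdeal A v ≤ maximalIdeal A := by
  rintro _ ⟨f, rfl⟩
  exact apply_mem_of_mem_smul_top hv f

theorem orderIdeal_coe_le {F : Type u} [AddCommGroup F] [Module A F] {S : Submodule A F} (y : S) :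
    orderIdeal A (y : F) ≤ orderIdeal A y := by
  rintro _ ⟨f, rfl⟩
  exact ⟨f ∘ₗ S.subtype, rfl⟩

theorem GradeGE.coe_of_orderIdeal [IsLocalRing A] [IsNoetherianRing A] {N : Type u}
    [AddCommGroup N] [Module A N] [Module.Finite A N] (hN : ∃ n, PdLE A N n) (Q : MinFreeRes A N)
    {i : ℕ} (y : LinearMap.range (Q.d i)) (h : GradeGE A (orderIdeal A y) (i + 1)) :
    GradeGE A (orderIdeal A (y : Q.F i)) (i + 1) := by
  refine h.of_forall_associatedPrimes (orderIdeal_coe_le_maximalIdeal (Q.min i y.2)) ?_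
  intro w hw hl p hp hcp
  obtain ⟨hprime, a, ha⟩ := mem_associatedPrimes_quotient_ofList hp
  obtain ⟨n, hn⟩ := hN
  have := Q.fin i
  exact orderIdeal_le_of_coe_le hw ha hn Q.toProjRes hl y hcp

end Grade

section Shift

variable {A : Type u} [CommRing A]

theorem MinFreeRes.hasFiniteFreeResolution_of_subsingleton [IsLocalRing A] {N : Type u}
    [AddCommGroup N] [Module A N] (Q : MinFreeRes A N) {n : ℕ}
    (h : ∀ j, n ≤ j → Subsingleton (Q.F j)) : HasFiniteFreeResolution A N :=
  ⟨Q.toProjRes, n, fun j => ⟨Q.free j, Q.fin j⟩, h⟩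

/-- A syzygy of a minimal resolution is itself minimally resolved by the later terms. -/
theorem MinFreeRes.exists_minFreeRes_range [IsLocalRing A] (i : ℕ) :
    ∀ {N : Type u} [AddCommGroup N] [Module A N] (Q : MinFreeRes A N),
      ∃ Q' : MinFreeRes A (LinearMap.range (Q.d i)), ∀ j, Q'.F j = Q.F (i + 1 + j) := by
  induction i with
  | zero =>
    intro N _ _ Q
    refine ⟨Q.shift, fun j => ?_⟩
    change Q.F (j + 1) = _
    congr 1
    omega
  | succ i ih =>
    intro N _ _ Q
    obtain ⟨Q', h⟩ := ih Q.shift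
    refine ⟨Q', fun j => (h j).trans ?_⟩
    change Q.F (i + 1 + j + 1) = _
    congr 1
    omega

theorem gradeGE_coe_of_orderIdealConjecture [IsLocalRing A] [IsNoetherianRing A]
    (hA : OrderIdealConjecture A) {N : Type u} [AddCommGroup N] [Module A N] [Module.Finite A N]
    (hN : ∃ n, PdLE A N n) (Q : MinFreeRes A N) {i : ℕ} (y : LinearMap.range (Q.d i))
    (hy : y ∉ maximalIdeal A • (⊤ : Submodule A (LinearMap.range (Q.d i)))) :
    GradeGE A (orderIdeal A (y : Q.F i)) (i + 1) := by
  have := Q.fin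
  refine GradeGE.coe_of_orderIdeal hN Q y (hA _ _ _ inferInstance ?_ (i + 1)
    ⟨N, _, _, Q.toProjRes, fun n => ⟨Q.free n, Q.fin n⟩, ⟨LinearEquiv.refl _ _⟩⟩ y hy)
  obtain ⟨Q', hQ'⟩ := Q.exists_minFreeRes_range i
  obtain ⟨n, hn⟩ := hN
  refine Q'.hasFiniteFreeResolution_of_subsingleton (n := n) fun j hj => ?_
  rw [hQ']
  exact Q.subsingleton_of_pdLE n hn _ (by omega)

end Shift

section Reduction

open RingTheory.Sequence Pointwise

variable {A : Type u} [CommRing A]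

theorem GradeGE.mono {J K : Ideal A} {k : ℕ} (hJK : J ≤ K) (h : GradeGE A J k) :
    GradeGE A K k := by
  obtain rfl | ⟨rs, hl, hrs, hreg⟩ := h
  · exact Or.inl (top_le_iff.1 hJK)
  · exact Or.inr ⟨rs, hl, fun r hr => hJK (hrs r hr), hreg⟩

theorem List.exists_map_mk_eq_of_forall_mem_map {I J : Ideal A} (rs : List (A ⧸ I))
    (h : ∀ r ∈ rs, r ∈ J.map (Ideal.Quotient.mk I)) :
    ∃ zs : List A, zs.map (Ideal.Quotient.mk I) = rs ∧ ∀ z ∈ zs, z ∈ J := by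
  induction rs with
  | nil => exact ⟨[], rfl, by simp⟩
  | cons r rs ih =>
    obtain ⟨zs, rfl, hzs⟩ := ih fun s hs => h s (List.mem_cons_of_mem _ hs)
    obtain ⟨z, hz, rfl⟩ := (Ideal.mem_map_iff_of_surjective _ Ideal.Quotient.mk_surjective).1
      (h r List.mem_cons_self)
    exact ⟨z :: zs, rfl, by simpa using ⟨hz, hzs⟩⟩

/-- A weakly regular sequence modulo `x` lifts to one starting with `x`. -/
theorem GradeGE.exists_isWeaklyRegular_cons [IsLocalRing A] {x : A} (hx : x ∈ maximalIdeal A)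
    (hA : IsSMulRegular A x) {J : Ideal A} (hJ : J ≤ maximalIdeal A) {k : ℕ}
    (h : GradeGE (A ⧸ Ideal.span {x}) (J.map (Ideal.Quotient.mk (Ideal.span {x}))) k) :
    ∃ zs : List A, zs.length = k ∧ (∀ z ∈ zs, z ∈ J) ∧ IsWeaklyRegular A (x :: zs) := by
  have := isLocalRing_quotient_span hx
  obtain htop | ⟨rs, rfl, hrs, hreg⟩ := h
  · have : J.map (Ideal.Quotient.mk (Ideal.span {x})) ≤ maximalIdeal _ :=
      Ideal.map_le_iff_le_comap.2 fun z hz => mk_mem_maximalIdeal_iff.2 (hJ hz)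
    rw [htop, top_le_iff] at this
    exact absurd this (maximalIdeal.isMaximal _).ne_top
  · obtain ⟨zs, rfl, hzs⟩ := List.exists_map_mk_eq_of_forall_mem_map rs hrs
    exact ⟨zs, by simp, hzs, isWeaklyRegular_cons_iff_quotient.2 ⟨hA, hreg⟩⟩

/-- Drop the first element of a weakly regular sequence in the maximal ideal. -/
theorem isWeaklyRegular_tail [IsLocalRing A] [IsNoetherianRing A] {x : A} {zs : List A}
    (h : IsWeaklyRegular A (x :: zs)) (hm : ∀ z ∈ x :: zs, z ∈ maximalIdeal A) :
    IsWeaklyRegular A zs :=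
  (isWeaklyRegular_concat_iff.1 (isWeaklyRegular_of_perm_of_subset_maximalIdeal h
    (List.perm_append_singleton x zs).symm hm)).1

variable {M N : Type u} [AddCommGroup M] [Module A M] [AddCommGroup N] [Module A N]

theorem map_mem_maximalIdeal_smul_top {A M N : Type*} [CommRing A] [AddCommGroup M] [Module A M]
    [AddCommGroup N] [IsLocalRing A] {I : Ideal A} [IsLocalRing (A ⧸ I)] [Module (A ⧸ I) N]
    (φ : M →+ N) (hφ : ∀ (a : A) m, φ (a • m) = Ideal.Quotient.mk I a • φ m)
    {m : M} (hm : m ∈ maximalIdeal A • (⊤ : Submodule A M)) :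
    φ m ∈ maximalIdeal (A ⧸ I) • (⊤ : Submodule (A ⧸ I) N) := by
  induction hm using Submodule.smul_induction_on' with
  | smul r hr m _ =>
    rw [hφ]
    exact Submodule.smul_mem_smul (mk_mem_maximalIdeal_iff.2 hr) trivial
  | add x _ y _ hx hy => rw [map_add]; exact add_mem hx hy

theorem exists_mem_maximalIdeal_smul_top {A M N : Type*} [CommRing A] [AddCommGroup M] [Module A M]
    [AddCommGroup N] [IsLocalRing A] {I : Ideal A} [IsLocalRing (A ⧸ I)] [Module (A ⧸ I) N]
    (φ : M →+ N) (hφ : ∀ (a : A) m, φ (a • m) = Ideal.Quotient.mk I a • φ m)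
    (hs : Function.Surjective φ)
    {t : N} (ht : t ∈ maximalIdeal (A ⧸ I) • (⊤ : Submodule (A ⧸ I) N)) :
    ∃ m ∈ maximalIdeal A • (⊤ : Submodule A M), φ m = t := by
  induction ht using Submodule.smul_induction_on' with
  | smul r hr n _ =>
    obtain ⟨r, rfl⟩ := Ideal.Quotient.mk_surjective r
    obtain ⟨m, rfl⟩ := hs n
    exact ⟨r • m, Submodule.smul_mem_smul (mk_mem_maximalIdeal_iff.1 hr) trivial, hφ r m⟩
  | add x _ y _ hx hy =>
    obtain ⟨a, ha, rfl⟩ := hx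
    obtain ⟨b, hb, rfl⟩ := hy
    exact ⟨a + b, add_mem ha hb, map_add _ _ _⟩

theorem mk_smul_quotSMulTop (x a : A) (m : M) :
    (Submodule.Quotient.mk (a • m) : QuotSMulTop x M) =
      Ideal.Quotient.mk (Ideal.span {x}) a • (Submodule.Quotient.mk m : QuotSMulTop x M) := rfl

theorem ProjRes.mem_range_of_smul_mem (P : ProjRes A M) {x : A} (hA : IsSMulRegular A x)
    (hM : IsSMulRegular M x) (hF : ∀ n, Module.Free A (P.F n)) (n : ℕ) {v : P.F n}
    (hv : x • v ∈ LinearMap.range (P.d n)) : v ∈ LinearMap.range (P.d n) := by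
  cases n with
  | zero =>
    rw [← P.exact0, LinearMap.mem_ker, map_smul] at hv
    rw [← P.exact0, LinearMap.mem_ker]
    exact hM.right_eq_zero_of_smul hv
  | succ n =>
    have := hF n
    rw [← P.exact, LinearMap.mem_ker, map_smul] at hv
    rw [← P.exact, LinearMap.mem_ker]
    exact (isSMulRegular_of_free hA).right_eq_zero_of_smul hv

/-- Reduction of a minimal free resolution of `M` modulo an element regular on the ring and on
`M`. -/
noncomputable def MinFreeRes.reduction [IsLocalRing A] (Q : MinFreeRes A M) {x : A}
    [IsLocalRing (A ⧸ Ideal.span {x})] (hA : IsSMulRegular A x)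
    (hM : IsSMulRegular M x) : MinFreeRes (A ⧸ Ideal.span {x}) (QuotSMulTop x M) :=
  have hfree (n : ℕ) : Module.Free (A ⧸ Ideal.span {x}) (QuotSMulTop x (Q.F n)) := by
    have := Q.free n
    infer_instance
  have hexact0 : LinearMap.ker (quotMap x Q.ε) = LinearMap.range (quotMap x (Q.d 0)) :=
    (quotMap_exact x (LinearMap.exact_iff.2 Q.exact0) fun n _ => Q.surj n).linearMap_ker_eq
  have hmin (n : ℕ) : LinearMap.range (quotMap x (Q.d n)) ≤
      maximalIdeal _ • (⊤ : Submodule _ (QuotSMulTop x (Q.F n))) := by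
    rintro _ ⟨v, rfl⟩
    obtain ⟨v, rfl⟩ := Submodule.Quotient.mk_surjective _ v
    exact map_mem_maximalIdeal_smul_top (Submodule.mkQ _).toAddMonoidHom
      (mk_smul_quotSMulTop x) (Q.min n ⟨v, rfl⟩)
  { F n := ModuleCat.of _ (QuotSMulTop x (Q.F n))
    d n := quotMap x (Q.d n)
    ε := quotMap x Q.ε
    projective n := have := hfree n; inferInstanceAs (Module.Projective _ (QuotSMulTop x (Q.F n)))
    surj := quotMap_surjective x Q.surj
    exact0 := hexact0
    exact n := (quotMap_exact x (LinearMap.exact_iff.2 (Q.exact n)) fun _ =>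
      Q.mem_range_of_smul_mem hA hM Q.free n).linearMap_ker_eq
    free := hfree
    fin n := have := Q.fin n; Module.Finite.of_restrictScalars_finite A _ (QuotSMulTop x (Q.F n))
    min_aug := hexact0.trans_le (hmin 0)
    min := hmin }

theorem orderIdeal_apply_le_map {B P T : Type u} [CommRing B] [Algebra A B] [AddCommGroup P]
    [Module A P] [Module.Projective A P] [AddCommGroup T] [Module A T] [Module B T]
    [IsScalarTower A B T] (hB : Function.Surjective (algebraMap A B)) (π : P →ₗ[A] T) (m : P) :
    orderIdeal B (π m) ≤ (orderIdeal A m).map (algebraMap A B) := by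
  rintro _ ⟨f, rfl⟩
  obtain ⟨g, hg⟩ := Module.projective_lifting_property (Algebra.linearMap A B)
    (f.restrictScalars A ∘ₗ π) hB
  have := LinearMap.congr_fun hg m
  change _ = f (π m) at this
  change f (π m) ∈ _
  rw [← this]
  exact Ideal.mem_map_of_mem _ ⟨g, rfl⟩

theorem MinFreeRes.exists_isWeaklyRegular_cons_of_reduction [IsLocalRing A] [IsNoetherianRing A]
    [Module.Finite A M] (hpd : ∃ n, PdLE A M n) (Q : MinFreeRes A M) {x : A}
    (hx : x ∈ maximalIdeal A) [IsLocalRing (A ⧸ Ideal.span {x})]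
    (hOIC : OrderIdealConjecture (A ⧸ Ideal.span {x})) (hA : IsSMulRegular A x)
    (hM : IsSMulRegular M x) {i : ℕ} (y : LinearMap.range (Q.d i))
    (hy : y ∉ maximalIdeal A • (⊤ : Submodule A (LinearMap.range (Q.d i)))) :
    ∃ zs : List A, zs.length = i + 1 ∧ (∀ z ∈ zs, z ∈ orderIdeal A (y : Q.F i)) ∧
      IsWeaklyRegular A (x :: zs) := by
  refine GradeGE.exists_isWeaklyRegular_cons hx hA
    (orderIdeal_coe_le_maximalIdeal (Q.min i y.2)) ?_
  have := Q.projective i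
  refine GradeGE.mono (orderIdeal_apply_le_map Ideal.Quotient.mk_surjective
    (Submodule.mkQ (x • (⊤ : Submodule A (Q.F i)))) (y : Q.F i)) ?_
  have : Module.Finite (A ⧸ Ideal.span {x}) (QuotSMulTop x M) :=
    Module.Finite.of_restrictScalars_finite A _ _
  let φ : LinearMap.range (Q.d i) →+ LinearMap.range (quotMap x (Q.d i)) :=
    { toFun v := ⟨Submodule.Quotient.mk v.1, by
        obtain ⟨w, hw⟩ := v.2
        exact ⟨Submodule.Quotient.mk w, by rw [quotMap_mk, hw]⟩⟩
      map_zero' := rfl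
      map_add' _ _ := rfl }
  have hφ : Function.Surjective φ := by
    rintro ⟨_, w, rfl⟩
    obtain ⟨w, rfl⟩ := Submodule.Quotient.mk_surjective _ w
    exact ⟨⟨Q.d i w, w, rfl⟩, rfl⟩
  refine gradeGE_coe_of_orderIdealConjecture hOIC (N := QuotSMulTop x M) ?_ (Q.reduction hA hM)
    (i := i) (φ y) ?_
  · obtain ⟨n, hn⟩ := hpd
    exact ⟨n, (pdLE_quotSMulTop_iff hx hA n hM).1 hn⟩
  · intro hmem
    obtain ⟨s, hs, hsy⟩ := exists_mem_maximalIdeal_smul_top φ (fun _ _ => rfl) hφ hmem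
    have h0 : (Submodule.Quotient.mk ((y : Q.F i) - s) : QuotSMulTop x (Q.F i)) = 0 := by
      rw [Submodule.Quotient.mk_sub, sub_eq_zero]
      exact (congrArg Subtype.val hsy).symm
    obtain ⟨v, hv⟩ := quotSMulTop_mk_eq_zero.1 h0
    have hvS := Q.mem_range_of_smul_mem hA hM Q.free i (v := v) (hv ▸ (y - s).2)
    refine hy ?_
    have : y = s + x • ⟨v, hvS⟩ := Subtype.ext (by simp [hv])
    rw [this]
    exact add_mem hs (Submodule.smul_mem_smul hx trivial)

end Reduction

section RegularLocal

variable {A : Type u} [CommRing A]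

theorem Ideal.exists_mem_notMem_of_finite_primes {I J : Ideal A} {S : Set (Ideal A)}
    (hS : S.Finite) (hp : ∀ p ∈ S, p.IsPrime) (hJ : ¬ I ≤ J) (hI : ∀ p ∈ S, ¬ I ≤ p) :
    ∃ x ∈ I, x ∉ J ∧ ∀ p ∈ S, x ∉ p := by
  by_contra! h
  have hsub : (I : Set A) ⊆ (J : Set A) ∪ J ∪ ⋃ p ∈ (↑hS.toFinset : Set (Ideal A)), (p : Set A) := by
    intro x hx
    by_cases hxJ : x ∈ J
    · exact Or.inl (Or.inl hxJ)
    · obtain ⟨p, hpS, hxp⟩ := h x hx hxJ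
      exact Or.inr (Set.mem_biUnion (by simpa using hpS) hxp)
  rcases (Ideal.subset_union_prime' (f := id) (a := J) (b := J)
    (fun p hpS => hp p (hS.mem_toFinset.1 hpS))).1 hsub with h | h | ⟨p, hpS, h⟩
  · exact hJ h
  · exact hJ h
  · exact hI p (hS.mem_toFinset.1 hpS) h

theorem IsRegularLocal.quotient [IsLocalRing A] (h : IsRegularLocal A) {x : A}
    (hx : x ∈ maximalIdeal A) (hx2 : x ∉ maximalIdeal A ^ 2) [IsLocalRing (A ⧸ Ideal.span {x})] :
    IsRegularLocal (A ⧸ Ideal.span {x}) ∧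
      ∃ k : ℕ, ringKrullDim (A ⧸ Ideal.span {x}) = k ∧ ringKrullDim A = (k + 1 : ℕ) := by
  obtain ⟨hN, n, v, hv, hdim⟩ := h
  obtain ⟨a, ha⟩ := (Submodule.mem_span_range_iff_exists_fun A).1 (hv ▸ hx)
  obtain ⟨i, hi⟩ : ∃ i, IsUnit (a i) := by
    by_contra! hu
    refine hx2 (ha ▸ Ideal.sum_mem _ fun i _ => ?_)
    rw [pow_two]
    exact Ideal.mul_mem_mul ((mem_maximalIdeal _).2 (hu i))
      (hv ▸ Ideal.subset_span (Set.mem_range_self i))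
  obtain _ | k := n
  · exact i.elim0
  let π := Ideal.Quotient.mk (Ideal.span {x})
  have hgen : Ideal.span (Set.range fun j => π (v (i.succAbove j))) =
      maximalIdeal (A ⧸ Ideal.span {x}) := by
    apply le_antisymm
    · rw [Ideal.span_le]
      rintro _ ⟨j, rfl⟩
      exact mk_mem_maximalIdeal_iff.2 (hv ▸ Ideal.subset_span (Set.mem_range_self _))
    · intro z hz
      obtain ⟨z, rfl⟩ := Ideal.Quotient.mk_surjective z
      have hz := mk_mem_maximalIdeal_iff.1 hz
      rw [← hv] at hz
      have hle : Ideal.span (Set.range v) ≤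
          (Ideal.span (Set.range fun j => π (v (i.succAbove j)))).comap π := by
        rw [Ideal.span_le]
        rintro _ ⟨l, rfl⟩
        have hmem (j) : π (v (i.succAbove j)) ∈
            Ideal.span (Set.range fun j => π (v (i.succAbove j))) :=
          Ideal.subset_span ⟨j, rfl⟩
        obtain rfl | ⟨j, rfl⟩ := Fin.eq_self_or_eq_succAbove i l
        · have h0 := (congrArg π ha).trans
            (Ideal.Quotient.eq_zero_iff_mem.2 (Ideal.mem_span_singleton_self x))
          rw [Fin.sum_univ_succAbove _ l, map_add, smul_eq_mul, map_mul] at h0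
          change π (v l) ∈ Ideal.span (Set.range fun j => π (v (l.succAbove j)))
          rw [← Ideal.unit_mul_mem_iff_mem _ (hi.map π), eq_neg_of_add_eq_zero_left h0, map_sum]
          refine neg_mem (Ideal.sum_mem _ fun j _ => ?_)
          rw [smul_eq_mul, map_mul]
          exact Ideal.mul_mem_left _ _ (hmem j)
        · exact hmem j
      exact hle hz
  have hle : ringKrullDim (A ⧸ Ideal.span {x}) ≤ k := by
    refine (ringKrullDim_le_spanFinrank_maximalIdeal _).trans ?_
    rw [← hgen]
    have h1 := Submodule.spanFinrank_span_le_ncard_of_finite (R := A ⧸ Ideal.span {x})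
      (Set.finite_range fun j => π (v (i.succAbove j)))
    have h2 : (Set.range fun j => π (v (i.succAbove j))).ncard ≤ k := by
      rw [← Set.image_univ]
      refine (Set.ncard_image_le Set.finite_univ).trans ?_
      simp [Set.ncard_univ]
    exact_mod_cast h1.trans h2
  have hge := ringKrullDim_le_ringKrullDim_quotient_add_card {x} (by
    simpa [Ideal.jacobson_bot] using IsLocalRing.maximalIdeal_le_jacobson (⊥ : Ideal A) hx)
  rw [Finset.coe_singleton, Finset.card_singleton, hdim] at hge
  have hk : ringKrullDim (A ⧸ Ideal.span {x}) = k := by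
    refine le_antisymm hle ?_
    generalize ringKrullDim (A ⧸ Ideal.span {x}) = d at hge
    cases d with
    | bot => simp at hge
    | coe d =>
      cases d with
      | top => exact le_top
      | coe d =>
        norm_cast at hge ⊢
        omega
  exact ⟨⟨inferInstance, k, _, hgen, hk⟩, k, hk, hdim⟩

theorem IsRegularLocal.isDomain [IsLocalRing A] (h : IsRegularLocal A) : IsDomain A := by
  obtain ⟨n, hn⟩ : ∃ n : ℕ, ringKrullDim A = n := ⟨_, h.2.choose_spec.choose_spec.2⟩
  have hN := h.1
  induction n generalizing A with
  | zero =>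
    obtain ⟨-, k, v, hv, hk⟩ := h
    rw [hn] at hk
    obtain rfl : k = 0 := by exact_mod_cast hk.symm
    have : maximalIdeal A = ⊥ := by rw [← hv]; simp
    exact (isField_iff_maximalIdeal_eq.2 this).isDomain
  | succ n ih =>
    have hht : (maximalIdeal A).height = (n + 1 : ℕ) := by
      have := IsLocalRing.maximalIdeal_height_eq_ringKrullDim (R := A)
      rw [hn] at this
      exact_mod_cast this
    obtain ⟨x, hx, hx2, hxp⟩ := Ideal.exists_mem_notMem_of_finite_primes
      (I := maximalIdeal A) (J := maximalIdeal A ^ 2)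
      (Ideal.finite_minimalPrimes_of_isNoetherianRing A ⊥)
      (fun p hp => hp.1.1) (fun hle => by
        have h0 : maximalIdeal A = ⊥ :=
          Submodule.eq_bot_of_le_smul_of_le_jacobson_bot (maximalIdeal A) (maximalIdeal A)
            (IsNoetherian.noetherian _) (by rwa [smul_eq_mul, ← pow_two])
            (IsLocalRing.maximalIdeal_le_jacobson _)
        have h1 : IsField A := isField_iff_maximalIdeal_eq.2 h0
        rw [ringKrullDim_eq_zero_of_isField h1] at hn
        norm_cast at hn) (fun p hp hle => by
        have := hp.1.1
        have hpm : p = maximalIdeal A := le_antisymm (le_maximalIdeal this.ne_top) hle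
        have := Ideal.height_eq_zero_iff.2 hp
        rw [hpm, hht] at this
        norm_cast at this)
    have := isLocalRing_quotient_span hx
    obtain ⟨hreg, k, hk, hk'⟩ := h.quotient hx hx2
    have hkn : k = n := by
      rw [hn] at hk'
      have : n + 1 = k + 1 := by exact_mod_cast hk'
      omega
    have := ih hreg (hkn ▸ hk) hreg.1
    have hprime : (Ideal.span {x}).IsPrime := (Ideal.Quotient.isDomain_iff_prime _).1 this
    obtain ⟨p, hp, hpx⟩ := Ideal.exists_minimalPrimes_le (bot_le (a := Ideal.span {x}))
    have hpp := hp.1.1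
    have hp0 : p = ⊥ := by
      refine Submodule.eq_bot_of_le_smul_of_le_jacobson_bot (Ideal.span {x}) p
        (IsNoetherian.noetherian _) (fun z hz => ?_)
        (((Ideal.span_singleton_le_iff_mem _).2 hx).trans (IsLocalRing.maximalIdeal_le_jacobson _))
      obtain ⟨b, rfl⟩ := Ideal.mem_span_singleton'.1 (hpx hz)
      rw [mul_comm]
      exact Submodule.smul_mem_smul (Ideal.mem_span_singleton_self x)
        ((hpp.mem_or_mem hz).resolve_right (hxp p hp))
    rw [hp0] at hpp
    exact IsDomain.of_bot_isPrime A

end RegularLocal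

section MinimalKernel

theorem map_mem_smul_top {A : Type*} [CommRing A] {M M' : Type*} [AddCommGroup M] [Module A M]
    [AddCommGroup M'] [Module A M'] (I : Ideal A) (f : M →ₗ[A] M') {m : M}
    (hm : m ∈ I • (⊤ : Submodule A M)) : f m ∈ I • (⊤ : Submodule A M') := by
  have : f m ∈ (I • (⊤ : Submodule A M)).map f := Submodule.mem_map_of_mem hm
  rw [Submodule.map_smul''] at this
  exact Submodule.smul_mono le_rfl le_top this

/-- `K` is the kernel of a minimal free cover of `M`. -/
def IsMinKer (A : Type u) [CommRing A] [IsLocalRing A] (K M : Type u) [AddCommGroup K] [Module A K]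
    [AddCommGroup M] [Module A M] : Prop :=
  ∃ (n : ℕ) (f : (Fin n → A) →ₗ[A] M), Function.Surjective f ∧
    LinearMap.ker f ≤ maximalIdeal A • (⊤ : Submodule A (Fin n → A)) ∧
      Nonempty (K ≃ₗ[A] LinearMap.ker f)

variable {A : Type u} [CommRing A] [IsLocalRing A] {K K' M M' : Type u} [AddCommGroup K]
  [Module A K] [AddCommGroup K'] [Module A K'] [AddCommGroup M] [Module A M] [AddCommGroup M']
  [Module A M']

theorem IsMinKer.congr_right (h : IsMinKer A K M) (e : M ≃ₗ[A] M') : IsMinKer A K M' := by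
  obtain ⟨n, f, hf, hk, ⟨e'⟩⟩ := h
  have : LinearMap.ker (e.toLinearMap ∘ₗ f) = LinearMap.ker f := LinearEquiv.ker_comp _ _
  exact ⟨n, e.toLinearMap ∘ₗ f, e.surjective.comp hf, this ▸ hk,
    ⟨e'.trans (LinearEquiv.ofEq _ _ this.symm)⟩⟩

theorem IsMinKer.of_free {F : Type u} [AddCommGroup F] [Module A F] [Module.Free A F]
    [Module.Finite A F] {f : F →ₗ[A] M} (hf : Function.Surjective f)
    (hk : LinearMap.ker f ≤ maximalIdeal A • (⊤ : Submodule A F)) :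
    IsMinKer A (LinearMap.ker f) M := by
  let β := (Module.finBasis A F).equivFun
  have hker : LinearMap.ker (f ∘ₗ β.symm.toLinearMap) = (LinearMap.ker f).map β.toLinearMap := by
    rw [LinearMap.ker_comp]
    exact (Submodule.map_equiv_eq_comap_symm β _).symm
  refine ⟨_, f ∘ₗ β.symm.toLinearMap, hf.comp β.symm.surjective, ?_, ?_⟩
  · intro c hc
    simpa using map_mem_smul_top _ β.toLinearMap (hk hc)
  · rw [hker]
    exact ⟨β.submoduleMap _⟩

theorem surjective_of_forall_sub_mem [Module.Finite A M] (φ : M →ₗ[A] M)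
    (h : ∀ m, φ m - m ∈ maximalIdeal A • (⊤ : Submodule A M)) : Function.Surjective φ := by
  rw [← LinearMap.range_eq_top, ← top_le_iff]
  refine Submodule.le_of_le_smul_of_le_jacobson_bot Module.Finite.fg_top
    (maximalIdeal_le_jacobson _) fun m _ => ?_
  rw [← sub_sub_cancel (φ m) m]
  exact sub_mem (Submodule.mem_sup_left ⟨m, rfl⟩) (Submodule.mem_sup_right (h m))

/-- A composite of lifts between minimal free covers is bijective. -/
theorem bijective_comp_of_minimal_cover {n p : ℕ} {f : (Fin n → A) →ₗ[A] M}
    {g : (Fin p → A) →ₗ[A] M}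
    (hk : LinearMap.ker f ≤ maximalIdeal A • (⊤ : Submodule A (Fin n → A)))
    {a : (Fin n → A) →ₗ[A] (Fin p → A)} {b : (Fin p → A) →ₗ[A] (Fin n → A)}
    (ha : g ∘ₗ a = f) (hb : f ∘ₗ b = g) : Function.Bijective (b ∘ₗ a) := by
  have : Function.Surjective (b ∘ₗ a) := surjective_of_forall_sub_mem _ fun m => hk (by
    rw [LinearMap.mem_ker, map_sub, LinearMap.comp_apply, ← LinearMap.comp_apply f b, hb,
      ← LinearMap.comp_apply, ha, sub_self])
  exact ⟨OrzechProperty.injective_of_surjective_endomorphism _ this, this⟩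

theorem IsMinKer.nonempty_equiv (h : IsMinKer A K M) (h' : IsMinKer A K' M) :
    Nonempty (K ≃ₗ[A] K') := by
  obtain ⟨n, f, hf, hfk, ⟨e⟩⟩ := h
  obtain ⟨p, g, hg, hgk, ⟨e'⟩⟩ := h'
  obtain ⟨a, ha⟩ := Module.projective_lifting_property g f hg
  obtain ⟨b, hb⟩ := Module.projective_lifting_property f g hf
  have h1 := bijective_comp_of_minimal_cover hfk ha hb
  have h2 := bijective_comp_of_minimal_cover hgk hb ha
  let α := LinearEquiv.ofBijective a
    ⟨Function.Injective.of_comp (f := b) h1.1, Function.Surjective.of_comp (g := b) h2.2⟩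
  have hker : (LinearMap.ker g).comap α.toLinearMap = LinearMap.ker f := by
    rw [← LinearMap.ker_comp, ← ha]
    rfl
  rw [← hker] at e
  exact ⟨e.trans ((α.ofSubmodule' _).trans e'.symm)⟩

theorem MinFreeRes.isMinKer (Q : MinFreeRes A M) : IsMinKer A (LinearMap.range (Q.d 0)) M := by
  have := Q.free 0
  have := Q.fin 0
  rw [← Q.exact0]
  exact IsMinKer.of_free Q.surj Q.min_aug

theorem MinFreeRes.isMinKer_range (Q : MinFreeRes A M) (i : ℕ) :
    IsMinKer A (LinearMap.range (Q.d (i + 1))) (LinearMap.range (Q.d i)) := by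
  have := Q.free (i + 1)
  have := Q.fin (i + 1)
  have h : LinearMap.ker (Q.d i).rangeRestrict = LinearMap.range (Q.d (i + 1)) := by
    rw [LinearMap.ker_rangeRestrict, Q.exact]
  have := IsMinKer.of_free (Q.d i).surjective_rangeRestrict (h.trans_le (Q.min (i + 1)))
  rwa [h] at this

theorem MinFreeRes.nonempty [IsNoetherianRing A] [Module.Finite A M] :
    Nonempty (MinFreeRes A M) := by
  choose n f hf hk using fun X : {X : ModuleCat.{u} A // Module.Finite A X} =>
    have := X.2
    exists_minimal_cover (A := A) X.1
  let X : ℕ → {X : ModuleCat.{u} A // Module.Finite A X} := fun k =>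
    Nat.rec ⟨ModuleCat.of A M, inferInstanceAs (Module.Finite A M)⟩
      (fun _ X => ⟨ModuleCat.of A (LinearMap.ker (f X)),
        inferInstanceAs (Module.Finite A (LinearMap.ker (f X)))⟩) k
  let d (k : ℕ) : (Fin (n (X (k + 1))) → A) →ₗ[A] (Fin (n (X k)) → A) :=
    (LinearMap.ker (f (X k))).subtype ∘ₗ f (X (k + 1))
  have hr (k : ℕ) : LinearMap.range (d k) = LinearMap.ker (f (X k)) := by
    rw [LinearMap.range_comp, LinearMap.range_eq_top.2 (hf (X (k + 1))), Submodule.map_top,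
      Submodule.range_subtype]
  have hd (k : ℕ) : LinearMap.ker (d k) = LinearMap.ker (f (X (k + 1))) :=
    LinearMap.ker_comp_of_ker_eq_bot _ (Submodule.ker_subtype _)
  exact ⟨{
    F k := ModuleCat.of A (Fin (n (X k)) → A)
    d := d
    ε := f (X 0)
    projective k := inferInstanceAs (Module.Projective A (Fin (n (X k)) → A))
    surj := hf (X 0)
    exact0 := (hr 0).symm
    exact k := (hd k).trans (hr (k + 1)).symm
    free k := inferInstanceAs (Module.Free A (Fin (n (X k)) → A))
    fin k := inferInstanceAs (Module.Finite A (Fin (n (X k)) → A))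
    min_aug := hk (X 0)
    min k := (hr k).trans_le (hk (X k)) }⟩

end MinimalKernel

section ChangeOfRings

variable {A : Type u} [CommRing A] {w : A}

/-- Reduction of the coordinates of a vector modulo `w`. -/
abbrev piMk (w : A) (n : ℕ) : (Fin n → A) →ₗ[A] (Fin n → A ⧸ Ideal.span {w}) :=
  (Algebra.linearMap A (A ⧸ Ideal.span {w})).compLeft (Fin n)

theorem piMk_surjective (n : ℕ) : Function.Surjective (piMk w n) := fun c =>
  ⟨fun j => (Ideal.Quotient.mk_surjective (c j)).choose,
    funext fun j => (Ideal.Quotient.mk_surjective (c j)).choose_spec⟩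

theorem piMk_eq_zero_iff {n : ℕ} {c : Fin n → A} : piMk w n c = 0 ↔ ∃ b, w • b = c := by
  constructor
  · intro h
    have (j : Fin n) : ∃ b, b * w = c j :=
      Ideal.mem_span_singleton'.1 (Ideal.Quotient.eq_zero_iff_mem.1 (congrFun h j))
    choose b hb using this
    exact ⟨b, funext fun j => by rw [Pi.smul_apply, smul_eq_mul, mul_comm, hb]⟩
  · rintro ⟨b, rfl⟩
    funext j
    exact Ideal.Quotient.eq_zero_iff_mem.2
      (Ideal.mul_mem_right _ _ (Ideal.mem_span_singleton_self w))

variable [IsLocalRing A] [IsLocalRing (A ⧸ Ideal.span {w})]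

theorem mem_maximalIdeal_smul_top_of_piMk {n : ℕ} {c : Fin n → A}
    (h : piMk w n c ∈ maximalIdeal (A ⧸ Ideal.span {w}) •
      (⊤ : Submodule (A ⧸ Ideal.span {w}) (Fin n → A ⧸ Ideal.span {w}))) :
    c ∈ maximalIdeal A • (⊤ : Submodule A (Fin n → A)) :=
  mem_smul_top_pi_iff.2 fun j => mk_mem_maximalIdeal_iff.1 (mem_smul_top_pi_iff.1 h j)

omit [IsLocalRing (A ⧸ Ideal.span {w})] in
theorem mem_maximalIdeal_of_mul_mem_sq (hw2 : w ∉ maximalIdeal A ^ 2) {b : A}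
    (h : w * b ∈ maximalIdeal A ^ 2) : b ∈ maximalIdeal A := by
  by_contra hb
  exact hw2 ((Ideal.mul_unit_mem_iff_mem _ (by simpa using hb)).1 h)

variable {S T T₁ : Type u} [AddCommGroup S] [Module A S]
  [AddCommGroup T] [Module A T] [Module (A ⧸ Ideal.span {w}) T]
  [IsScalarTower A (A ⧸ Ideal.span {w}) T]
  [AddCommGroup T₁] [Module A T₁] [Module (A ⧸ Ideal.span {w}) T₁]
  [IsScalarTower A (A ⧸ Ideal.span {w}) T₁]

/-- The first syzygy over `A` of a module over `A ⧸ (w)`, as a cover of its first syzygy over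
`A ⧸ (w)`. -/
theorem exists_equiv_ker_comp_piMk {n : ℕ}
    {f : (Fin n → A ⧸ Ideal.span {w}) →ₗ[A ⧸ Ideal.span {w}] T}
    (hf : Function.Surjective f)
    (hk : LinearMap.ker f ≤ maximalIdeal (A ⧸ Ideal.span {w}) • ⊤) (hS : IsMinKer A S T) :
    LinearMap.ker (f.restrictScalars A ∘ₗ piMk w n) ≤ maximalIdeal A • ⊤ ∧
      Nonempty (S ≃ₗ[A] LinearMap.ker (f.restrictScalars A ∘ₗ piMk w n)) := by
  have h : LinearMap.ker (f.restrictScalars A ∘ₗ piMk w n) ≤ maximalIdeal A • ⊤ :=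
    fun c hc => mem_maximalIdeal_smul_top_of_piMk (hk hc)
  exact ⟨h, hS.nonempty_equiv ⟨n, _, hf.comp (piMk_surjective n), h, ⟨LinearEquiv.refl _ _⟩⟩⟩

/-- If `S` is the first syzygy over `A` of an `A ⧸ (w)`-module `T` with first syzygy `T₁` over
`A ⧸ (w)`, then `S` and `T₁` have the same first syzygy over `A`. -/
theorem IsMinKer.of_quotient [IsNoetherianRing A] (hw2 : w ∉ maximalIdeal A ^ 2)
    (hreg : IsSMulRegular A w) {S' : Type u} [AddCommGroup S'] [Module A S']
    (hT : IsMinKer (A ⧸ Ideal.span {w}) T₁ T) (hS : IsMinKer A S T) (hS' : IsMinKer A S' S) :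
    IsMinKer A S' T₁ := by
  obtain ⟨n, f, hf, hfk, ⟨e⟩⟩ := hT
  obtain ⟨hUm, ⟨σ⟩⟩ := exists_equiv_ker_comp_piMk hf hfk hS
  have : Module.Finite (A ⧸ Ideal.span {w}) T₁ := Module.Finite.equiv e.symm
  have : Module.Finite A T₁ := Module.Finite.trans (A ⧸ Ideal.span {w}) T₁
  set U := LinearMap.ker (f.restrictScalars A ∘ₗ piMk w n) with hU
  let t : U →ₗ[A] T₁ := (e.symm.toLinearMap.restrictScalars A) ∘ₗ
    ((piMk w n).domRestrict U).codRestrict ((LinearMap.ker f).restrictScalars A) fun u => u.2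
  have ht0 (u : U) : t u = 0 ↔ ∃ b, w • b = (u : Fin n → A) := by
    rw [← piMk_eq_zero_iff]
    change e.symm _ = 0 ↔ _
    rw [LinearEquiv.map_eq_zero_iff]
    exact Subtype.ext_iff
  have hwU (b : Fin n → A) : w • b ∈ U := by
    rw [hU, LinearMap.mem_ker, LinearMap.comp_apply, piMk_eq_zero_iff.2 ⟨b, rfl⟩, map_zero]
  obtain ⟨p, g, hg, hgk⟩ := exists_minimal_cover (A := A) T₁
  have ht : Function.Surjective t := by
    intro z
    obtain ⟨c, hc⟩ := piMk_surjective (w := w) n (e z : Fin n → _)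
    have hcU : c ∈ U := by
      change f (piMk w n c) = 0
      rw [hc]
      exact (e z).2
    refine ⟨⟨c, hcU⟩, ?_⟩
    change e.symm _ = z
    rw [LinearEquiv.symm_apply_eq]
    exact Subtype.ext hc
  obtain ⟨γ, hγ⟩ := Module.projective_lifting_property t g ht
  have htγ (a) : t (γ a) = g a := LinearMap.congr_fun hγ a
  let ω : (Fin n → A) →ₗ[A] U := (LinearMap.lsmul A (Fin n → A) w).codRestrict U hwU
  let h : (Fin p → A) × (Fin n → A) →ₗ[A] U := γ.coprod ω
  have hh (a b) : ((h (a, b) : U) : Fin n → A) = γ a + w • b := rfl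
  have hinj : Function.Injective fun b : Fin n → A => w • b := isSMulRegular_of_free hreg
  have hhs : Function.Surjective h := by
    intro u
    obtain ⟨a, ha⟩ := hg (t u)
    obtain ⟨b, hb⟩ := (ht0 (u - γ a)).1 (by rw [map_sub, htγ, ha, sub_self])
    refine ⟨(a, b), Subtype.ext ?_⟩
    rw [hh, hb, AddSubgroupClass.coe_sub, add_sub_cancel]
  have hga {a b} (hab : h (a, b) = 0) : g a = 0 := by
    rw [← htγ, ht0]
    refine ⟨-b, ?_⟩
    have := congrArg Subtype.val hab
    rw [hh] at this
    rw [smul_neg]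
    exact (eq_neg_of_add_eq_zero_left this).symm
  have hhk : LinearMap.ker h ≤ maximalIdeal A • ⊤ := by
    rintro ⟨a, b⟩ hab
    have ha := hgk (hga hab)
    have hb : b ∈ maximalIdeal A • (⊤ : Submodule A (Fin n → A)) := by
      refine mem_smul_top_pi_iff.2 fun j => mem_maximalIdeal_of_mul_mem_sq hw2 ?_
      have hsq : ((γ a : U) : Fin n → A) j ∈ maximalIdeal A ^ 2 := by
        have := map_mem_smul_top _ γ ha
        refine Submodule.smul_induction_on (p := fun u : U => (u : Fin n → A) j ∈ maximalIdeal A ^ 2)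
          this (fun r hr u _ => ?_) fun x y hx hy => add_mem hx hy
        rw [pow_two]
        exact Ideal.mul_mem_mul hr (mem_smul_top_pi_iff.1 (hUm u.2) j)
      have := congrFun (congrArg Subtype.val hab) j
      rw [hh] at this
      have : w * b j = -((γ a : U) : Fin n → A) j := eq_neg_of_add_eq_zero_right this
      rw [this]
      exact neg_mem hsq
    have : ((a, b) : (Fin p → A) × (Fin n → A)) =
        LinearMap.inl A _ _ a + LinearMap.inr A _ _ b := by simp
    rw [this]
    exact add_mem (map_mem_smul_top _ _ ha) (map_mem_smul_top _ _ hb)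
  obtain ⟨ψ⟩ := (hS'.congr_right σ).nonempty_equiv (IsMinKer.of_free hhs hhk)
  let q : LinearMap.ker h →ₗ[A] LinearMap.ker g :=
    ((LinearMap.fst A _ _).domRestrict (LinearMap.ker h)).codRestrict _ fun v => hga v.2
  have hq : Function.Bijective q := by
    constructor
    · rw [injective_iff_map_eq_zero]
      rintro ⟨⟨a, b⟩, hab⟩ h0
      obtain rfl : a = 0 := congrArg Subtype.val h0
      have := congrArg Subtype.val hab
      rw [hh, map_zero] at this
      have : w • b = w • (0 : Fin n → A) := by simpa using this
      obtain rfl : b = 0 := hinj this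
      rfl
    · rintro ⟨a, ha⟩
      obtain ⟨b, hb⟩ := (ht0 (γ a)).1 ((htγ a).trans ha)
      exact ⟨⟨(a, -b), Subtype.ext (by rw [hh, ← hb]; simp)⟩, rfl⟩
  exact ⟨p, g, hg, hgk, ⟨ψ.trans (LinearEquiv.ofBijective q hq)⟩⟩

end ChangeOfRings

section Descent

theorem orderIdeal_linearEquiv {A : Type u} [CommRing A] {N N' : Type u} [AddCommGroup N]
    [Module A N] [AddCommGroup N'] [Module A N'] (e : N ≃ₗ[A] N') (y : N) :
    orderIdeal A (e y) = orderIdeal A y := by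
  apply le_antisymm
  · rintro _ ⟨f, rfl⟩
    exact ⟨f ∘ₗ e.toLinearMap, rfl⟩
  · rintro _ ⟨f, rfl⟩
    exact ⟨f ∘ₗ e.symm.toLinearMap, congrArg f (e.symm_apply_apply y)⟩

variable {A : Type u} [CommRing A] [IsLocalRing A] {w : A} [IsLocalRing (A ⧸ Ideal.span {w})]
  {S T F : Type u} [AddCommGroup S] [Module A S]
  [AddCommGroup T] [Module A T] [Module (A ⧸ Ideal.span {w}) T]
  [IsScalarTower A (A ⧸ Ideal.span {w}) T]
  [AddCommGroup F] [Module (A ⧸ Ideal.span {w}) F] [Module.Free (A ⧸ Ideal.span {w}) F]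
  [Module.Finite (A ⧸ Ideal.span {w}) F]

theorem exists_basis_cover {f : F →ₗ[A ⧸ Ideal.span {w}] T} (hf : Function.Surjective f)
    (hk : LinearMap.ker f ≤ maximalIdeal (A ⧸ Ideal.span {w}) • ⊤) (hS : IsMinKer A S T) :
    ∃ (n : ℕ) (β : F ≃ₗ[A ⧸ Ideal.span {w}] (Fin n → A ⧸ Ideal.span {w}))
      (U : Submodule A (Fin n → A)) (_ : S ≃ₗ[A] U), U ≤ maximalIdeal A • ⊤ ∧
        ∀ c, c ∈ U ↔ β.symm (piMk w n c) ∈ LinearMap.ker f := by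
  let β := (Module.finBasis (A ⧸ Ideal.span {w}) F).equivFun
  have hfβ : Function.Surjective (f ∘ₗ β.symm.toLinearMap) := hf.comp β.symm.surjective
  obtain ⟨h, ⟨σ⟩⟩ := exists_equiv_ker_comp_piMk hfβ (fun c hc => by
    simpa using map_mem_smul_top _ β.toLinearMap (hk (show β.symm c ∈ LinearMap.ker f from hc))) hS
  exact ⟨_, β, _, σ, h, fun c => Iff.rfl⟩

theorem subsingleton_of_isMinKer_subsingleton (hw2 : w ∉ maximalIdeal A ^ 2) [Subsingleton S]
    {f : F →ₗ[A ⧸ Ideal.span {w}] T} (hf : Function.Surjective f)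
    (hk : LinearMap.ker f ≤ maximalIdeal (A ⧸ Ideal.span {w}) • ⊤) (hS : IsMinKer A S T) :
    Subsingleton F := by
  obtain ⟨n, β, U, σ, hU, hmem⟩ := exists_basis_cover hf hk hS
  have := σ.symm.subsingleton
  have hw0 : w ≠ 0 := fun h => hw2 (h ▸ zero_mem _)
  cases n with
  | zero => exact β.subsingleton
  | succ n =>
    have h1 : w • (1 : Fin (n + 1) → A) ∈ U := by
      rw [hmem, piMk_eq_zero_iff.2 ⟨1, rfl⟩, map_zero]
      exact zero_mem _
    have := congrFun (congrArg Subtype.val (Subsingleton.elim (⟨_, h1⟩ : U) 0)) 0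
    exact absurd (by simpa using this) hw0

/-- A minimal generator of the first `A`-syzygy of `T` with order ideal inside `m²` descends to a
minimal generator of the first `A ⧸ (w)`-syzygy of `T`. -/
theorem exists_minimal_generator_quotient (hw2 : w ∉ maximalIdeal A ^ 2)
    {f : F →ₗ[A ⧸ Ideal.span {w}] T} (hf : Function.Surjective f)
    (hk : LinearMap.ker f ≤ maximalIdeal (A ⧸ Ideal.span {w}) • ⊤) (hS : IsMinKer A S T)
    {y : S} (hy : y ∉ maximalIdeal A • (⊤ : Submodule A S))
    (hO : orderIdeal A y ≤ maximalIdeal A ^ 2) :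
    ∃ v : LinearMap.ker f, v ∉ maximalIdeal (A ⧸ Ideal.span {w}) •
      (⊤ : Submodule (A ⧸ Ideal.span {w}) (LinearMap.ker f)) ∧
      orderIdeal (A ⧸ Ideal.span {w}) (v : F) ≤
        (orderIdeal A y).map (Ideal.Quotient.mk (Ideal.span {w})) := by
  obtain ⟨n, β, U, σ, hU, hmem⟩ := exists_basis_cover hf hk hS
  let φ : U →+ LinearMap.ker f :=
    { toFun u := ⟨β.symm (piMk w n u), (hmem u).1 u.2⟩
      map_zero' := Subtype.ext (by simp)
      map_add' _ _ := Subtype.ext (by simp) }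
  have hφ (a : A) (u : U) : φ (a • u) = Ideal.Quotient.mk (Ideal.span {w}) a • φ u := by
    refine Subtype.ext ?_
    change β.symm (piMk w n (a • (u : Fin n → A))) = _ • β.symm (piMk w n u)
    rw [← map_smul]
    rfl
  have hφs : Function.Surjective φ := by
    intro z
    obtain ⟨c, hc⟩ := piMk_surjective (w := w) n (β z)
    have hcz : β.symm (piMk w n c) = z := by rw [hc, β.symm_apply_apply]
    exact ⟨⟨c, (hmem c).2 (hcz ▸ z.2)⟩, Subtype.ext hcz⟩
  refine ⟨φ (σ y), fun hv => hy ?_, ?_⟩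
  · obtain ⟨u, hu, huy⟩ := exists_mem_maximalIdeal_smul_top φ hφ hφs hv
    have h0 : piMk w n ((σ y : U) - (u : U) : Fin n → A) = 0 := by
      have := congrArg Subtype.val huy
      have : piMk w n (u : Fin n → A) = piMk w n (σ y : Fin n → A) := β.symm.injective this
      rw [map_sub, this, sub_self]
    obtain ⟨b, hb⟩ := piMk_eq_zero_iff.1 h0
    have hbm : b ∈ maximalIdeal A • (⊤ : Submodule A (Fin n → A)) := by
      refine mem_smul_top_pi_iff.2 fun j => mem_maximalIdeal_of_mul_mem_sq hw2 ?_
      have h1 : (σ y : Fin n → A) j ∈ maximalIdeal A ^ 2 :=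
        hO ⟨LinearMap.proj j ∘ₗ U.subtype ∘ₗ σ.toLinearMap, rfl⟩
      have h2 : (u : Fin n → A) j ∈ maximalIdeal A ^ 2 := by
        refine Submodule.smul_induction_on (p := fun u : U => (u : Fin n → A) j ∈ maximalIdeal A ^ 2)
          hu (fun r hr u _ => ?_) fun x y hx hy => add_mem hx hy
        rw [pow_two]
        exact Ideal.mul_mem_mul hr (mem_smul_top_pi_iff.1 (hU u.2) j)
      have : w * b j = (σ y : Fin n → A) j - (u : Fin n → A) j := congrFun hb j
      rw [this]
      exact sub_mem h1 h2
    let ω : (Fin n → A) →ₗ[A] U := (LinearMap.lsmul A (Fin n → A) w).codRestrict U fun c => by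
      rw [hmem, LinearMap.lsmul_apply, piMk_eq_zero_iff.2 ⟨c, rfl⟩, map_zero]
      exact zero_mem _
    have hσ : σ y = u + ω b := Subtype.ext (by
      change (σ y : Fin n → A) = u + w • b
      rw [hb, add_sub_cancel])
    have := map_mem_smul_top _ σ.symm.toLinearMap
      (hσ ▸ add_mem hu (map_mem_smul_top _ ω hbm) :
        σ y ∈ maximalIdeal A • (⊤ : Submodule A U))
    simpa using this
  · change orderIdeal _ (β.symm _) ≤ _
    rw [orderIdeal_linearEquiv]
    refine (orderIdeal_apply_le_map Ideal.Quotient.mk_surjective (piMk w n) _).trans ?_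
    refine Ideal.map_mono ((orderIdeal_coe_le _).trans ?_)
    rw [orderIdeal_linearEquiv]

/-- Comparison of the minimal resolutions of an `A ⧸ (w)`-module over `A` and over `A ⧸ (w)`. -/
theorem MinFreeRes.exists_isMinKer [IsNoetherianRing A] (hw2 : w ∉ maximalIdeal A ^ 2)
    (hreg : IsSMulRegular A w) (Q : MinFreeRes A T) (G : MinFreeRes (A ⧸ Ideal.span {w}) T)
    (i : ℕ) : ∃ (X : Type u) (_ : AddCommGroup X) (_ : Module A X)
      (_ : Module (A ⧸ Ideal.span {w}) X) (_ : IsScalarTower A (A ⧸ Ideal.span {w}) X)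
      (f : G.F i →ₗ[A ⧸ Ideal.span {w}] X), Function.Surjective f ∧
        LinearMap.ker f = LinearMap.range (G.d i) ∧ IsMinKer A (LinearMap.range (Q.d i)) X := by
  induction i with
  | zero => exact ⟨T, _, _, _, inferInstance, G.ε, G.surj, G.exact0, Q.isMinKer⟩
  | succ i ih =>
    obtain ⟨X, _, _, _, _, f, hf, hfk, hX⟩ := ih
    let _ : Module A (LinearMap.range (G.d i)) :=
      Module.compHom _ (algebraMap A (A ⧸ Ideal.span {w}))
    have : IsScalarTower A (A ⧸ Ideal.span {w}) (LinearMap.range (G.d i)) :=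
      IsScalarTower.of_algebraMap_smul fun _ _ => rfl
    refine ⟨LinearMap.range (G.d i), _, _, _, this, (G.d i).rangeRestrict,
      (G.d i).surjective_rangeRestrict, by rw [LinearMap.ker_rangeRestrict, G.exact], ?_⟩
    have := G.free i
    have := G.fin i
    have hG : IsMinKer (A ⧸ Ideal.span {w}) (LinearMap.range (G.d i)) X := by
      rw [← hfk]
      exact IsMinKer.of_free hf (hfk.trans_le (G.min i))
    exact hG.of_quotient hw2 hreg hX (Q.isMinKer_range i)

end Descent

section Main

open RingTheory.Sequence

variable {A : Type u} [CommRing A] [IsLocalRing A] [IsNoetherianRing A] [IsDomain A]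
  {M : Type u} [AddCommGroup M] [Module A M] [Module.Finite A M]

omit [Module.Finite A M] in
/-- An order ideal not contained in `m²` is controlled by the quotient by one of its elements. -/
theorem gradeGE_of_mem_orderIdeal (hpd : ∃ n, PdLE A M n) (Q : MinFreeRes A M) {i : ℕ}
    (y : LinearMap.range (Q.d i))
    (hy : y ∉ maximalIdeal A • (⊤ : Submodule A (LinearMap.range (Q.d i)))) {x : A}
    (hx : x ∈ maximalIdeal A) (hx0 : x ≠ 0) (hxy : x ∈ orderIdeal A y)
    [IsLocalRing (A ⧸ Ideal.span {x})] (hOIC : OrderIdealConjecture (A ⧸ Ideal.span {x})) :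
    GradeGE A (orderIdeal A y) (i + 1) := by
  have hreg : IsSMulRegular A x := IsSMulRegular.of_ne_zero hx0
  cases i with
  | zero =>
    exact Or.inr ⟨[x], rfl, by simpa using hxy,
      (isWeaklyRegular_cons_iff_quotient).2 ⟨hreg, IsWeaklyRegular.nil _ _⟩⟩
  | succ i =>
    have := Q.free 0
    have := Q.fin 0
    obtain ⟨n, hn⟩ := hpd
    have hn' : PdLE A (LinearMap.range (Q.d 0)) n :=
      Q.toProjRes.pdLE_succ_iff.1 (hn.mono (Nat.le_succ n))
    obtain ⟨zs, hl, hzs, h⟩ := Q.shift.exists_isWeaklyRegular_cons_of_reduction ⟨n, hn'⟩ hx hOIC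
      hreg (isSMulRegular_submodule (isSMulRegular_of_free hreg) _) (i := i) y hy
    refine Or.inr ⟨x :: zs, by simp [hl], ?_, h⟩
    rw [List.forall_mem_cons]
    exact ⟨hxy, fun z hz => orderIdeal_coe_le y (hzs z hz)⟩

theorem gradeGE_of_isSMulRegular (hpd : ∃ n, PdLE A M n) (Q : MinFreeRes A M) {i : ℕ}
    (y : LinearMap.range (Q.d i))
    (hy : y ∉ maximalIdeal A • (⊤ : Submodule A (LinearMap.range (Q.d i)))) {x : A}
    (hx : x ∈ maximalIdeal A) (hx0 : x ≠ 0) (hM : IsSMulRegular M x)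
    [IsLocalRing (A ⧸ Ideal.span {x})] (hOIC : OrderIdealConjecture (A ⧸ Ideal.span {x})) :
    GradeGE A (orderIdeal A y) (i + 1) := by
  obtain ⟨zs, hl, hzs, h⟩ := Q.exists_isWeaklyRegular_cons_of_reduction hpd hx hOIC
    (IsSMulRegular.of_ne_zero hx0) hM y hy
  refine Or.inr ⟨zs, hl, fun z hz => orderIdeal_coe_le y (hzs z hz), isWeaklyRegular_tail h ?_⟩
  rw [List.forall_mem_cons]
  exact ⟨hx, fun z hz => orderIdeal_coe_le_maximalIdeal (Q.min i y.2) (hzs z hz)⟩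

theorem gradeGE_of_mem_annihilator (hpd : ∃ n, PdLE A M n) (Q : MinFreeRes A M) {i : ℕ}
    (y : LinearMap.range (Q.d i))
    (hy : y ∉ maximalIdeal A • (⊤ : Submodule A (LinearMap.range (Q.d i)))) {w : A}
    (hw : w ∈ maximalIdeal A) (hw2 : w ∉ maximalIdeal A ^ 2) (hwM : w ∈ Module.annihilator A M)
    [IsLocalRing (A ⧸ Ideal.span {w})] (hOIC : OrderIdealConjecture (A ⧸ Ideal.span {w}))
    (hO : orderIdeal A y ≤ maximalIdeal A ^ 2) :
    GradeGE A (orderIdeal A y) (i + 1) := by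
  have hreg : IsSMulRegular A w := IsSMulRegular.of_ne_zero fun h => hw2 (h ▸ zero_mem _)
  have htors : Module.IsTorsionBySet A M (Ideal.span {w}) := by
    rw [Module.isTorsionBySet_span_singleton_iff]
    exact fun m => Module.mem_annihilator.1 hwM m
  let _ : Module (A ⧸ Ideal.span {w}) M := htors.module
  have : IsScalarTower A (A ⧸ Ideal.span {w}) M := htors.isScalarTower
  have : Module.Finite (A ⧸ Ideal.span {w}) M := Module.Finite.of_restrictScalars_finite A _ _
  obtain ⟨G⟩ := MinFreeRes.nonempty (A := A ⧸ Ideal.span {w}) (M := M)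
  obtain ⟨n, hn⟩ := hpd
  have hG : ∃ k, PdLE (A ⧸ Ideal.span {w}) M k := by
    refine exists_pdLE_of_subsingleton n G.toProjRes fun j hj => ?_
    obtain ⟨X, _, _, _, _, f, hf, hfk, hX⟩ := Q.exists_isMinKer hw2 hreg G j
    have := Q.subsingleton_of_pdLE n hn (j + 1) (by omega)
    have : Subsingleton (LinearMap.range (Q.d j)) :=
      (Q.d j).surjective_rangeRestrict.subsingleton
    have := G.free j
    have := G.fin j
    exact subsingleton_of_isMinKer_subsingleton hw2 hf (hfk.trans_le (G.min j)) hX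
  obtain ⟨X, _, _, _, _, f, hf, hfk, hX⟩ := Q.exists_isMinKer hw2 hreg G i
  have := G.free i
  have := G.fin i
  have hv := exists_minimal_generator_quotient hw2 hf (hfk.trans_le (G.min i)) hX hy hO
  rw [hfk] at hv
  obtain ⟨v, hv, hvO⟩ := hv
  have hOm : orderIdeal A y ≤ maximalIdeal A := hO.trans (Ideal.pow_le_self two_ne_zero)
  obtain ⟨zs, hl, hzs, h⟩ := GradeGE.exists_isWeaklyRegular_cons hw hreg hOm
    ((gradeGE_coe_of_orderIdealConjecture hOIC hG G v hv).mono hvO)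
  refine Or.inr ⟨zs, hl, hzs, isWeaklyRegular_tail h ?_⟩
  rw [List.forall_mem_cons]
  exact ⟨hw, fun z hz => hOm (hzs z hz)⟩

omit [IsDomain A] in
theorem exists_isSMulRegular_notMem_sq [Nontrivial M] {r : A} (hr : r ∈ maximalIdeal A)
    (hrM : IsSMulRegular M r) : ∃ x ∈ maximalIdeal A, x ∉ maximalIdeal A ^ 2 ∧ IsSMulRegular M x := by
  have hr0 : r ≠ 0 := by
    rintro rfl
    obtain ⟨m, hm⟩ := exists_ne (0 : M)
    exact hm (hrM (by simp))
  obtain ⟨x, hx, hx2, hxp⟩ := Ideal.exists_mem_notMem_of_finite_primes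
    (associatedPrimes.finite A M) (fun p hp => hp.isPrime)
    (I := maximalIdeal A) (J := maximalIdeal A ^ 2) (fun hle => hr0 (by
      have h0 : maximalIdeal A = ⊥ :=
        Submodule.eq_bot_of_le_smul_of_le_jacobson_bot (maximalIdeal A) (maximalIdeal A)
          (IsNoetherian.noetherian _) (by rwa [smul_eq_mul, ← pow_two])
          (maximalIdeal_le_jacobson _)
      simpa [h0] using hr)) fun p hp hle => by
      have : r ∈ {r : A | IsSMulRegular M r}ᶜ := by
        rw [← biUnion_associatedPrimes_eq_compl_regular]
        exact Set.mem_biUnion hp (hle hr)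
      exact this hrM
  refine ⟨x, hx, hx2, ?_⟩
  by_contra hxM
  have : x ∈ {r : A | IsSMulRegular M r}ᶜ := hxM
  rw [← biUnion_associatedPrimes_eq_compl_regular] at this
  obtain ⟨p, hp, hxp'⟩ := Set.mem_iUnion₂.1 this
  exact hxp p hp hxp'

end Main

/-- Let `(R,m)` be a regular local ring of dimension `n` and
let `M` be a finitely generated `R`-module of finite projective dimension.
Assume the order ideal conjecture holds for every regular local ring of
dimension `n − 1`.  If the annihilator `ann_R M` contains an element of
`m ∖ m²`, or if `depth_R M > 0`, then `M` satisfies the order ideal conjecture: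
for every `i ≥ 0` and every minimal generator `y` of the `i`-th syzygy module
`Syz^i_R(M)` (the image of the `i`-th differential in a minimal free resolution
of `M`), the order ideal `O(y)` has grade at least `i`.  (Below, the image of
`Q.d i : F_{i+1} → F_i` is the `(i+1)`-st syzygy module of `M`; the case `i = 0`
of the assertion, `grade O(y) ≥ 0`, is trivial.) -/
theorem statement15
    (R : Type u) [CommRing R] [IsLocalRing R] (hreg : IsRegularLocal R)
    (n : ℕ) (hdim : ringKrullDim R = n)
    (hOIC : ∀ (R' : Type u) [CommRing R'] [IsLocalRing R'],
      IsRegularLocal R' → ringKrullDim R' = (n - 1 : ℕ) → OrderIdealConjecture R')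
    (M : Type u) [AddCommGroup M] [Module R M] [Module.Finite R M]
    (hpd : HasFiniteFreeResolution R M)
    (hcase : (∃ w ∈ Module.annihilator R M,
        w ∈ maximalIdeal R ∧ w ∉ (maximalIdeal R) ^ 2) ∨
      (∃ r ∈ maximalIdeal R, IsSMulRegular M r)) :
    ∀ (Q : MinFreeRes R M) (i : ℕ)
      (y : ↥(LinearMap.range (Q.d i))),
        y ∉ (maximalIdeal R) • (⊤ : Submodule R ↥(LinearMap.range (Q.d i))) →
          GradeGE R (orderIdeal R y) (i + 1) := by
  intro Q i y hy
  have := hreg.1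
  have := hreg.isDomain
  have hOIC' (x : R) (hx : x ∈ maximalIdeal R) (hx2 : x ∉ maximalIdeal R ^ 2)
      [IsLocalRing (R ⧸ Ideal.span {x})] : OrderIdealConjecture (R ⧸ Ideal.span {x}) := by
    obtain ⟨h, k, hk, hk'⟩ := hreg.quotient hx hx2
    have hnk : n = k + 1 := by
      rw [hdim] at hk'
      exact_mod_cast hk'
    exact hOIC _ h (by rw [hk, hnk]; rfl)
  have hne (x : R) (hx2 : x ∉ maximalIdeal R ^ 2) : x ≠ 0 := fun h => hx2 (h ▸ zero_mem _)
  have hpd := hpd.exists_pdLE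
  obtain ⟨w, hwM, hw, hw2⟩ | ⟨r, hr, hrM⟩ := hcase
  · by_cases htop : orderIdeal R y = ⊤
    · exact Or.inl htop
    by_cases hO : orderIdeal R y ≤ maximalIdeal R ^ 2
    · have := isLocalRing_quotient_span hw
      exact gradeGE_of_mem_annihilator hpd Q y hy hw hw2 hwM (hOIC' w hw hw2) hO
    · obtain ⟨u, hu, hu2⟩ := SetLike.not_le_iff_exists.1 hO
      have hum := le_maximalIdeal htop hu
      have := isLocalRing_quotient_span hum
      exact gradeGE_of_mem_orderIdeal hpd Q y hy hum (hne u hu2) hu (hOIC' u hum hu2)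
  · cases subsingleton_or_nontrivial M with
    | inl _ =>
      have := Q.subsingleton_of_subsingleton i
      exact absurd (Subsingleton.elim y 0 ▸ zero_mem _) hy
    | inr _ =>
      obtain ⟨x, hx, hx2, hxM⟩ := exists_isSMulRegular_notMem_sq hr hrM
      have := isLocalRing_quotient_span hx
      exact gradeGE_of_isSMulRegular hpd Q y hy hx (hne x hx2) hxM (hOIC' x hx hx2)
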